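/- Let (R, 𝔪) be a local Noetherian ring, 𝔞 an ideal, M a nonzero finitely generated R-module of dimension d with H^d_𝔞(M) ≠ 0, and 0 = ∩_{j=1}^n N_j a reduced primary decomposition of 0 in M with N_j 𝔭_j-primary. Then Ann_R(H^d_𝔞(M)) = Ann_R(M / ∩_{cd(𝔞, R/𝔭_j) = d} N_j). -/

import Mathlib

open CategoryTheory

universe u

/-- `H^i_I(M) ≠ 0`: the `i`-th local cohomology of `M` with respect to `I` is nonzero. -/
abbrev LCNonzero {R : Type u} [CommRing R] (I : Ideal R) (i : ℕ)
    (M : Type u) [AddCommGroup M] [Module R M] : Prop :=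
  Nontrivial ((localCohomology I i).obj (ModuleCat.of R M))

/-- Cohomological dimension `cd(I, M) = sup {i : H^i_I(M) ≠ 0}`, as an element of
`WithBot ℕ∞` (it is `⊥` if all local cohomology of `M` vanishes). -/
noncomputable def cohDim {R : Type u} [CommRing R] (I : Ideal R)
    (M : Type u) [AddCommGroup M] [Module R M] : WithBot ℕ∞ :=
  sSup {n : WithBot ℕ∞ | ∃ i : ℕ, n = (i : ℕ∞) ∧ LCNonzero I i M}

/-- Krull dimension of a module, i.e. the Krull dimension of `R ⧸ Ann_R M`. -/
noncomputable def modDim (R : Type u) [CommRing R]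
    (M : Type u) [AddCommGroup M] [Module R M] : WithBot ℕ∞ :=
  ringKrullDim (R ⧸ Module.annihilator R M)

/-- A submodule `N ≤ M` is `p`-primary if `Ass_R (M ⧸ N) = {p}`. -/
def IsPrimarySubmodule {R : Type u} [CommRing R] {M : Type u} [AddCommGroup M] [Module R M]
    (N : Submodule R M) (p : Ideal R) : Prop :=
  associatedPrimes R (M ⧸ N) = {p}

namespace LC
open Opposite Limits

/-- `φ` represents the class `h` in the (unopped) homology. -/
def RepK {R : Type u} [CommRing R] (K : ChainComplex (ModuleCat.{u} R)ᵒᵖ ℕ) (i : ℕ)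
    (φ : (K.X i).unop) (h : (K.homology i).unop) : Prop :=
  ∃ z : (K.opcycles i).unop, (K.pOpcycles i).unop.hom z = φ ∧ (K.homologyι i).unop.hom z = h

section RepK
variable {R : Type u} [CommRing R] (K : ChainComplex (ModuleCat.{u} R)ᵒᵖ ℕ) (i : ℕ)

lemma p_inj : Function.Injective (K.pOpcycles i).unop.hom := by
  have : Mono (K.pOpcycles i).unop := inferInstance
  exact (ModuleCat.mono_iff_injective _).1 this

lemma ι_surj : Function.Surjective (K.homologyι i).unop.hom := by
  have : Epi (K.homologyι i).unop := inferInstance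
  exact (ModuleCat.epi_iff_surjective _).1 this

lemma range_p : Function.Exact (K.pOpcycles i).unop.hom (K.d (i+1) i).unop.hom := by
  have h : (ShortComplex.mk (K.d (i+1) i) (K.pOpcycles i) (by simp)).Exact :=
    ShortComplex.exact_of_g_is_cokernel _ (K.opcyclesIsCokernel (i+1) i (by simp))
  exact (ShortComplex.ShortExact.moduleCat_exact_iff_function_exact _).1 h.unop

lemma range_q (j : ℕ) (hj : (ComplexShape.down ℕ).next i = j) :
    Function.Exact (K.fromOpcycles i j).unop.hom (K.homologyι i).unop.hom := by
  have h : (ShortComplex.mk (K.homologyι i) (K.fromOpcycles i j) (by simp)).Exact :=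
    ShortComplex.exact_of_f_is_kernel _ (K.homologyIsKernel i j hj)
  exact (ShortComplex.ShortExact.moduleCat_exact_iff_function_exact _).1 h.unop

variable {K i}
lemma RepK.unique {φ h h'} (H : RepK K i φ h) (H' : RepK K i φ h') : h = h' := by
  obtain ⟨z, rfl, rfl⟩ := H
  obtain ⟨z', h1, rfl⟩ := H'
  rw [p_inj K i h1]

lemma RepK.add {φ φ' h h'} (H : RepK K i φ h) (H' : RepK K i φ' h') :
    RepK K i (φ + φ') (h + h') := by
  obtain ⟨z, rfl, rfl⟩ := H
  obtain ⟨z', rfl, rfl⟩ := H'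
  exact ⟨z + z', by simp, by simp⟩

lemma RepK.smul {φ h} (r : R) (H : RepK K i φ h)  :
    RepK K i (r • φ) (r • h) := by
  obtain ⟨z, rfl, rfl⟩ := H
  exact ⟨r • z, by simp, by simp⟩

lemma RepK.ex (h) : ∃ φ, RepK K i φ h := by
  obtain ⟨z, rfl⟩ := ι_surj K i h
  exact ⟨_, z, rfl, rfl⟩

lemma RepK.closed {φ h} (H : RepK K i φ h) : (K.d (i+1) i).unop.hom φ = 0 := by
  obtain ⟨z, rfl, rfl⟩ := H
  exact (range_p K i _).2 ⟨z, rfl⟩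

lemma RepK.of_closed {φ} (H : (K.d (i+1) i).unop.hom φ = 0) : ∃ h, RepK K i φ h := by
  obtain ⟨z, rfl⟩ := (range_p K i _).1 H
  exact ⟨_, z, rfl, rfl⟩

lemma RepK.zero_iff (j : ℕ) (hj : (ComplexShape.down ℕ).next i = j) {φ} :
    RepK K i φ 0 ↔ ∃ ψ, (K.d i j).unop.hom ψ = φ := by
  have key : ∀ ψ, (K.d i j).unop.hom ψ = (K.pOpcycles i).unop.hom ((K.fromOpcycles i j).unop.hom ψ) := by
    intro ψ
    rw [← K.p_fromOpcycles i j]; rfl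
  constructor
  · rintro ⟨z, rfl, h⟩
    obtain ⟨ψ, rfl⟩ := (range_q K i j hj _).1 h
    exact ⟨ψ, key ψ⟩
  · rintro ⟨ψ, rfl⟩
    exact ⟨_, (key ψ).symm, (range_q K i j hj _).2 ⟨ψ, rfl⟩⟩

lemma RepK.map {L : ChainComplex (ModuleCat.{u} R)ᵒᵖ ℕ} (f : L ⟶ K) {φ h} (H : RepK K i φ h) :
    RepK L i ((f.f i).unop.hom φ) ((HomologicalComplex.homologyMap f i).unop.hom h) := by
  obtain ⟨z, rfl, rfl⟩ := H
  refine ⟨(HomologicalComplex.opcyclesMap f i).unop.hom z, ?_, ?_⟩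
  · have := HomologicalComplex.p_opcyclesMap f i
    have := congrArg (fun g => g.unop.hom z) this
    exact this
  · have := HomologicalComplex.homologyι_naturality f i
    have := congrArg (fun g => g.unop.hom z) this
    exact this.symm
end RepK

section RepE
variable {R : Type u} [CommRing R] {X Y : ModuleCat.{u} R} (P : ProjectiveResolution X)

/-- `φ : P_i → Y` represents the class `e` in `Ext`. -/
def RepE (i : ℕ) (Y : ModuleCat.{u} R) (φ : P.complex.X i ⟶ Y)
    (e : ((Ext R (ModuleCat.{u} R) i).obj (op X)).obj Y) : Prop :=
  ∃ h, RepK ((((linearYoneda R (ModuleCat.{u} R)).obj Y).rightOp.mapHomologicalComplex _).obj P.complex) i φ h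
    ∧ (P.isoLeftDerivedObj ((linearYoneda R (ModuleCat.{u} R)).obj Y).rightOp i).hom.unop.hom h = e

variable {P} {i : ℕ}

lemma iso_inj (Y : ModuleCat.{u} R) : Function.Bijective (P.isoLeftDerivedObj ((linearYoneda R (ModuleCat.{u} R)).obj Y).rightOp i).hom.unop.hom := by
  exact (ConcreteCategory.isIso_iff_bijective _).1 (inferInstanceAs (IsIso (P.isoLeftDerivedObj ((linearYoneda R (ModuleCat.{u} R)).obj Y).rightOp i).hom.unop))

lemma RepE.unique {φ h h'} (H : RepE P i Y φ h) (H' : RepE P i Y φ h') : h = h' := by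
  obtain ⟨z, h1, rfl⟩ := H
  obtain ⟨z', h2, rfl⟩ := H'
  rw [h1.unique h2]

lemma RepE.add {φ φ' h h'} (H : RepE P i Y φ h) (H' : RepE P i Y φ' h') :
    RepE P i Y (φ + φ') (h + h') := by
  obtain ⟨z, h1, rfl⟩ := H
  obtain ⟨z', h2, rfl⟩ := H'
  exact ⟨z + z', h1.add h2, map_add _ _ _⟩

lemma RepE.smul {φ h} (r : R) (H : RepE P i Y φ h)  :
    RepE P i Y (r • φ) (r • h) := by
  obtain ⟨z, h1, rfl⟩ := H
  exact ⟨r • z, h1.smul r, map_smul _ _ _⟩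

lemma RepE.ex (h) : ∃ φ, RepE P i Y φ h := by
  obtain ⟨z, rfl⟩ := (iso_inj (P := P) (i := i) Y).2 h
  obtain ⟨φ, h⟩ := RepK.ex z
  exact ⟨_, z, h, rfl⟩

lemma RepE.closed {φ h} (H : RepE P i Y φ h) : P.complex.d (i+1) i ≫ φ = 0 := by
  obtain ⟨z, h1, rfl⟩ := H
  exact h1.closed

lemma RepE.of_closed {φ : P.complex.X i ⟶ Y} (H : P.complex.d (i+1) i ≫ φ = 0) : ∃ h, RepE P i Y φ h := by
  obtain ⟨z, h⟩ := RepK.of_closed (K := ((((linearYoneda R (ModuleCat.{u} R)).obj Y).rightOp.mapHomologicalComplex _).obj P.complex)) (φ := φ) H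
  exact ⟨_, z, h, rfl⟩

lemma RepE.zero_iff (j : ℕ) (hj : (ComplexShape.down ℕ).next i = j) {φ} :
    RepE P i Y φ 0 ↔ ∃ ψ, P.complex.d i j ≫ ψ = φ := by
  constructor
  · rintro ⟨z, h1, h2⟩
    have : z = 0 := (iso_inj Y).1 (h2.trans (map_zero _).symm)
    subst this
    exact (RepK.zero_iff j hj).1 h1
  · rintro h
    exact ⟨0, (RepK.zero_iff j hj).2 h, map_zero _⟩

lemma RepE.mapY {Y'} (f : Y ⟶ Y') {φ h} (H : RepE P i Y φ h) :
    RepE P i Y' (φ ≫ f) ((((Ext R (ModuleCat.{u} R) i).obj (op X)).map f).hom h) := by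
  obtain ⟨z, h1, rfl⟩ := H
  refine ⟨_, h1.map (((NatTrans.mapHomologicalComplex ((linearYoneda R (ModuleCat.{u} R)).map f).rightOp _).app P.complex)), ?_⟩
  have h3 : (NatTrans.leftDerived ((linearYoneda R (ModuleCat.{u} R)).map f).rightOp i).app X ≫
      (P.isoLeftDerivedObj ((linearYoneda R (ModuleCat.{u} R)).obj Y).rightOp i).hom =
      (P.isoLeftDerivedObj ((linearYoneda R (ModuleCat.{u} R)).obj Y').rightOp i).hom ≫
        (HomologicalComplex.homologyFunctor _ (ComplexShape.down ℕ) i).map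
        ((NatTrans.mapHomologicalComplex ((linearYoneda R (ModuleCat.{u} R)).map f).rightOp _).app
          P.complex) := by
    rw [ProjectiveResolution.leftDerived_app_eq
      (((linearYoneda R (ModuleCat.{u} R)).map f).rightOp) P i]
    simp only [Category.assoc, Iso.inv_hom_id, Category.comp_id]
  have h4 := congrArg (fun k => k.unop.hom z) h3
  exact h4.symm

lemma RepE.mapX {X'} {P' : ProjectiveResolution X'} (f : X' ⟶ X) (g : P'.complex ⟶ P.complex) 
    (comm : g.f 0 ≫ P.π.f 0 = P'.π.f 0 ≫ f) {φ h} (H : RepE P i Y φ h) :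
    RepE P' i Y (g.f i ≫ φ) ((((Ext R (ModuleCat.{u} R) i).map f.op).app Y).hom h) := by
  obtain ⟨z, h1, rfl⟩ := H
  refine ⟨_, h1.map ((((linearYoneda R (ModuleCat.{u} R)).obj Y).rightOp.mapHomologicalComplex _).map g), ?_⟩
  have := ProjectiveResolution.isoLeftDerivedObj_hom_naturality f P' P g comm ((linearYoneda R (ModuleCat.{u} R)).obj Y).rightOp i
  have := congrArg (fun k => k.unop.hom z) this
  exact this.symm
end RepE
end LC

namespace LC
open Opposite Limits localCohomology

section
variable {R : Type u} [CommRing R]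

/-- Local cohomology module. -/
abbrev H (a : Ideal R) (i : ℕ) (N : Type u) [AddCommGroup N] [Module R N] : Type u :=
  ((localCohomology a i).obj (ModuleCat.of R N) : Type u)

/-- Functoriality. -/
noncomputable def Hmap (a : Ideal R) (i : ℕ) {N N' : Type u} [AddCommGroup N] [Module R N]
    [AddCommGroup N'] [Module R N'] (f : N →ₗ[R] N') : H a i N →ₗ[R] H a i N' :=
  ((localCohomology a i).map (ModuleCat.ofHom f)).hom

lemma Hmap_id (a : Ideal R) (i : ℕ) {N : Type u} [AddCommGroup N] [Module R N] :
    Hmap a i (LinearMap.id : N →ₗ[R] N) = LinearMap.id := by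
  have : ModuleCat.ofHom (LinearMap.id : N →ₗ[R] N) = 𝟙 _ := rfl
  simp [Hmap, this]

lemma Hmap_comp (a : Ideal R) (i : ℕ) {N N' N'' : Type u} [AddCommGroup N] [Module R N]
    [AddCommGroup N'] [Module R N'] [AddCommGroup N''] [Module R N''] (g : N' →ₗ[R] N'') (f : N →ₗ[R] N') :
    Hmap a i (g ∘ₗ f) = Hmap a i g ∘ₗ Hmap a i f := by
  simp [Hmap]

/-- Chosen resolution. -/
noncomputable def PR (a : Ideal R) (t : ℕ) : ProjectiveResolution (ModuleCat.of R (R ⧸ a ^ t)) :=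
  ProjectiveResolution.of _

/-- Terms. -/
abbrev Q (a : Ideal R) (t i : ℕ) : Type u := ((PR a t).complex.X i : Type u)

/-- Differential. -/
noncomputable def dQ (a : Ideal R) (t i : ℕ) : Q a t (i+1) →ₗ[R] Q a t i :=
  ((PR a t).complex.d (i+1) i).hom

lemma dQ_dQ (a : Ideal R) (t i : ℕ) : dQ a t i ∘ₗ dQ a t (i+1) = 0 := by
  have := (PR a t).complex.d_comp_d (i+2) (i+1) i
  exact congrArg ModuleCat.Hom.hom this

instance (a : Ideal R) (t i : ℕ) : Module.Projective R (Q a t i) := by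
  have := (PR a t).projective i
  exact (IsProjective.iff_projective _).2 this

/-- The quotient map. -/
noncomputable def qmap (a : Ideal R) {t s : ℕ} (h : t ≤ s) :
    ModuleCat.of R (R ⧸ a ^ s) ⟶ ModuleCat.of R (R ⧸ a ^ t) :=
  (ringModIdeals (idealPowersDiagram a)).map (X := op s) (Y := op t) (homOfLE h).op

/-- Transition chain map. -/
noncomputable def trC (a : Ideal R) {t s : ℕ} (h : t ≤ s) : (PR a s).complex ⟶ (PR a t).complex :=
  ProjectiveResolution.lift (qmap a h) _ _

/-- Transition map. -/
noncomputable def tr (a : Ideal R) {t s : ℕ} (h : t ≤ s) (i : ℕ) : Q a s i →ₗ[R] Q a t i :=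
  ((trC a h).f i).hom

lemma tr_d (a : Ideal R) {t s : ℕ} (h : t ≤ s) (i : ℕ) :
    tr a h i ∘ₗ dQ a s i = dQ a t i ∘ₗ tr a h (i+1) := by
  have := (trC a h).comm (i+1) i
  exact (congrArg ModuleCat.Hom.hom this).symm

/-- Colimit inclusion. -/
noncomputable def incl (a : Ideal R) (i t : ℕ) (N : ModuleCat.{u} R) :
    ((Ext R (ModuleCat.{u} R) i).obj (op (ModuleCat.of R (R ⧸ a ^ t)))).obj N ⟶
      (localCohomology a i).obj N :=
  (colimit.ι (diagram (idealPowersDiagram a) i) (op (op t))).app N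

lemma incl_nat (a : Ideal R) (i t : ℕ) {N N' : ModuleCat.{u} R} (f : N ⟶ N') :
    ((Ext R (ModuleCat.{u} R) i).obj (op (ModuleCat.of R (R ⧸ a ^ t)))).map f ≫ incl a i t N' =
      incl a i t N ≫ (localCohomology a i).map f :=
  (colimit.ι (diagram (idealPowersDiagram a) i) (op (op t))).naturality f

lemma incl_tr (a : Ideal R) (i : ℕ) {t s : ℕ} (h : t ≤ s) (N : ModuleCat.{u} R) :
    ((Ext R (ModuleCat.{u} R) i).map (qmap a h).op).app N ≫ incl a i s N = incl a i t N :=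
  congrArg (fun k => k.app N) (colimit.w (diagram (idealPowersDiagram a) i) (homOfLE h).op.op)

/-- colimit cocone. -/
noncomputable def inclColim (a : Ideal R) (i : ℕ) (N : ModuleCat.{u} R) :
    IsColimit (((evaluation _ _).obj N).mapCocone (colimit.cocone (diagram (idealPowersDiagram a) i))) :=
  isColimitOfPreserves ((evaluation _ _).obj N) (colimit.isColimit _)

instance : PreservesFilteredColimitsOfSize.{0, 0} (forget (ModuleCat.{u} R)) :=
  preservesFilteredColimitsOfSize_shrink.{0, u, 0, u} _

instance (F : ℕᵒᵖᵒᵖ ⥤ ModuleCat.{u} R) : PreservesColimit F (forget (ModuleCat.{u} R)) :=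
  have := PreservesFilteredColimitsOfSize.preserves_filtered_colimits
    (F := forget (ModuleCat.{u} R)) ℕᵒᵖᵒᵖ
  inferInstance

lemma incl_surj (a : Ideal R) (i : ℕ) (N : ModuleCat.{u} R) (x : (localCohomology a i).obj N) :
    ∃ t e, (incl a i t N).hom e = x := by
  obtain ⟨t, e, h⟩ := Concrete.isColimit_exists_rep _ (inclColim a i N) x
  exact ⟨t.unop.unop, e, h⟩

lemma incl_zero (a : Ideal R) (i : ℕ) (N : ModuleCat.{u} R) (t : ℕ) (e)
    (h : (incl a i t N).hom e = 0) :
    ∃ s, ∃ h : t ≤ s, (((Ext R (ModuleCat.{u} R) i).map (qmap a h).op).app N).hom e = 0 := by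
  obtain ⟨s, f, g, h⟩ := Concrete.isColimit_exists_of_rep_eq _ (inclColim a i N) (i := op (op t)) (j := op (op t)) e 0
    (h.trans (map_zero (incl a i t N).hom).symm)
  refine ⟨s.unop.unop, leOfHom f.unop.unop, h.trans ?_⟩
  exact map_zero (ModuleCat.Hom.hom (((diagram (idealPowersDiagram a) i ⋙ (evaluation _ _).obj N)).map g))

variable {N : Type u} [AddCommGroup N] [Module R N] {N' : Type u} [AddCommGroup N'] [Module R N'] 

/-- `φ` represents `h`. -/
def RepH (a : Ideal R) (i t : ℕ) (φ : Q a t i →ₗ[R] N) (h : H a i N) : Prop :=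
  ∃ e, RepE (PR a t) i (ModuleCat.of R N) (ModuleCat.ofHom φ) e ∧ (incl a i t _).hom e = h

variable {a : Ideal R} {i t : ℕ}

lemma RepH.unique {φ : Q a t i →ₗ[R] N} {h h'} (H : RepH a i t φ h) (H' : RepH a i t φ h') : h = h' := by
  obtain ⟨z, h1, rfl⟩ := H
  obtain ⟨z', h2, rfl⟩ := H'
  rw [h1.unique h2]

lemma RepH.add {φ φ' : Q a t i →ₗ[R] N} {h h'} (H : RepH a i t φ h) (H' : RepH a i t φ' h') :
    RepH a i t (φ + φ') (h + h') := by
  obtain ⟨z, h1, rfl⟩ := H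
  obtain ⟨z', h2, rfl⟩ := H'
  exact ⟨z + z', h1.add h2, map_add _ _ _⟩

lemma RepH.smul {φ : Q a t i →ₗ[R] N} {h} (r : R) (H : RepH a i t φ h)  :
    RepH a i t (r • φ) (r • h) := by
  obtain ⟨z, h1, rfl⟩ := H
  exact ⟨r • z, h1.smul r, map_smul _ _ _⟩

lemma RepH.ex (h : H a i N) : ∃ t, ∃ φ : Q a t i →ₗ[R] N, RepH a i t φ h := by
  obtain ⟨t, z, rfl⟩ := incl_surj a i _ h
  obtain ⟨φ, h⟩ := RepE.ex (P := PR a t) z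
  exact ⟨t, φ.hom, z, h, rfl⟩

lemma RepH.closed {φ : Q a t i →ₗ[R] N} {h} (H : RepH a i t φ h) : φ ∘ₗ dQ a t i = 0 := by
  obtain ⟨z, h1, rfl⟩ := H
  exact congrArg ModuleCat.Hom.hom h1.closed

lemma RepH.of_closed {φ : Q a t i →ₗ[R] N} (h : φ ∘ₗ dQ a t i = 0) : ∃ h, RepH a i t φ h := by
  obtain ⟨z, h⟩ := RepE.of_closed (P := PR a t) (φ := ModuleCat.ofHom φ) (ModuleCat.hom_ext h)
  exact ⟨_, z, h, rfl⟩

lemma RepH.map {φ : Q a t i →ₗ[R] N} {h} (H : RepH a i t φ h) (f : N →ₗ[R] N') :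
    RepH a i t (f ∘ₗ φ) (Hmap a i f h) := by
  obtain ⟨z, h1, rfl⟩ := H
  refine ⟨_, h1.mapY (ModuleCat.ofHom f), ?_⟩
  exact congrArg (fun k => k.hom z) (incl_nat a i t (ModuleCat.ofHom f))

lemma tr_comm {s : ℕ} (hs : t ≤ s) :
    (trC a hs).f 0 ≫ (PR a t).π.f 0 = (PR a s).π.f 0 ≫ qmap a hs := by
  have := ProjectiveResolution.lift_commutes (qmap a hs) (PR a s) (PR a t)
  have := congrArg (fun k => k.f 0) this
  simp only [HomologicalComplex.comp_f] at this
  refine this.trans ?_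
  simp [ChainComplex.single₀_map_f_zero]

lemma RepH.tr {φ : Q a t i →ₗ[R] N} {h} (H : RepH a i t φ h) {s : ℕ} (hs : t ≤ s) :
    RepH a i s (φ ∘ₗ tr a hs i) h := by
  obtain ⟨z, h1, rfl⟩ := H
  refine ⟨_, h1.mapX (P' := PR a s) (qmap a hs) (trC a hs) (tr_comm hs), ?_⟩
  exact congrArg (fun k => k.hom z) (incl_tr a i hs _)

lemma RepH.zero_aux {φ : Q a t i →ₗ[R] N} (h : RepH a i t φ 0) :
    ∃ s, ∃ hs : t ≤ s, RepE (PR a s) i (ModuleCat.of R N) (ModuleCat.ofHom (φ ∘ₗ LC.tr a hs i)) 0 := by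
  obtain ⟨e, h1, h2⟩ := h
  obtain ⟨s, hs, h3⟩ := incl_zero a i _ t e h2
  refine ⟨s, hs, ?_⟩
  have := h1.mapX (P' := PR a s) (qmap a hs) (trC a hs) (tr_comm hs)
  rw [h3] at this
  exact this

lemma RepH.zero_zero {φ : Q a t 0 →ₗ[R] N} (h : RepH a 0 t φ 0) :
    ∃ s, ∃ hs : t ≤ s, φ ∘ₗ LC.tr a hs 0 = 0 := by
  obtain ⟨s, hs, h⟩ := h.zero_aux
  refine ⟨s, hs, ?_⟩
  obtain ⟨ψ, h⟩ := (RepE.zero_iff 0 (by simp)).1 h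
  rw [(PR a s).complex.shape 0 0 (by simp)] at h
  exact (congrArg ModuleCat.Hom.hom h).symm.trans (by simp)

lemma RepH.zero_succ {φ : Q a t (i+1) →ₗ[R] N} (h : RepH a (i+1) t φ 0) :
    ∃ s, ∃ hs : t ≤ s, ∃ ψ : Q a s i →ₗ[R] N, ψ ∘ₗ dQ a s i = φ ∘ₗ LC.tr a hs (i+1) := by
  obtain ⟨s, hs, h⟩ := h.zero_aux
  obtain ⟨ψ, h⟩ := (RepE.zero_iff i (by simp)).1 h
  exact ⟨s, hs, ψ.hom, congrArg ModuleCat.Hom.hom h⟩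

lemma RepH.of_bdry (ψ : Q a t i →ₗ[R] N) : RepH a (i+1) t (ψ ∘ₗ dQ a t i) 0 :=
  ⟨0, (RepE.zero_iff i (by simp)).2 ⟨ModuleCat.ofHom ψ, rfl⟩, map_zero _⟩

end
end LC

namespace LC
open Opposite Limits localCohomology

lemma exists_linear_of_graph {R X Y : Type*} [CommRing R] [AddCommGroup X] [Module R X]
    [AddCommGroup Y] [Module R Y] (G : X → Y → Prop)
    (hadd : ∀ x x' y y', G x y → G x' y' → G (x + x') (y + y'))
    (hsmul : ∀ (r : R) x y, G x y → G (r • x) (r • y))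
    (htot : ∀ x, ∃ y, G x y) (huniq : ∀ y, G 0 y → y = 0) :
    ∃ f : X →ₗ[R] Y, ∀ x y, G x y ↔ f x = y := by
  have huniq' : ∀ x y y', G x y → G x y' → y = y' := by
    intro x y y' h h'
    have := hadd _ _ _ _ h (hsmul (-1) _ _ h')
    simp only [neg_smul, one_smul, add_neg_cancel] at this
    exact (sub_eq_zero.1 (by rw [sub_eq_add_neg]; exact huniq _ this))
  choose f hf using htot
  refine ⟨⟨⟨f, fun x y => ?_⟩, fun r x => ?_⟩, fun x y => ⟨fun h => huniq' _ _ _ (hf x) h, ?_⟩⟩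
  · exact huniq' _ _ _ (hf _) (hadd _ _ _ _ (hf x) (hf y))
  · exact huniq' _ _ _ (hf _) (hsmul _ _ _ (hf x))
  · rintro rfl; exact hf x

lemma factor {R X Y Z W : Type*} [CommRing R] [AddCommGroup X] [Module R X]
    [AddCommGroup Y] [Module R Y] [AddCommGroup Z] [Module R Z] [AddCommGroup W] [Module R W]
    {f : X →ₗ[R] Y} {g : Y →ₗ[R] Z} (hf : Function.Injective f) (hfg : Function.Exact f g)
    (φ : W →ₗ[R] Y) (h : g ∘ₗ φ = 0) : ∃ ψ : W →ₗ[R] X, f ∘ₗ ψ = φ := by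
  have : ∀ w, φ w ∈ LinearMap.range f := fun w => (hfg _).1 (LinearMap.congr_fun h w)
  refine ⟨(LinearEquiv.ofInjective f hf).symm.toLinearMap ∘ₗ φ.codRestrict _ this, ?_⟩
  ext w
  simp

section
variable {R : Type u} [CommRing R] {a : Ideal R} {i t : ℕ}
variable {N : Type u} [AddCommGroup N] [Module R N] {N' : Type u} [AddCommGroup N'] [Module R N']
  {N'' : Type u} [AddCommGroup N''] [Module R N'']

lemma RepH.sub {φ φ' : Q a t i →ₗ[R] N} {h h'} (H : RepH a i t φ h) (H' : RepH a i t φ' h') :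
    RepH a i t (φ - φ') (h - h') := by
  have := H.add (H'.smul (-1))
  simpa [sub_eq_add_neg] using this

lemma RepH.ex₂ (h : H a i N) (h' : H a i N') : ∃ t, ∃ (φ : Q a t i →ₗ[R] N) (φ' : Q a t i →ₗ[R] N'),
    RepH a i t φ h ∧ RepH a i t φ' h' := by
  obtain ⟨t, φ, h⟩ := RepH.ex h
  obtain ⟨t', φ', h'⟩ := RepH.ex h'
  exact ⟨max t t', _, _, h.tr (le_max_left t t'), h'.tr (le_max_right t t')⟩

lemma Hmap_smul (r : R) (f : N →ₗ[R] N') : Hmap a i (r • f) = r • Hmap a i f := by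
  ext h
  obtain ⟨t, φ, h⟩ := RepH.ex h
  have h1 := h.map (r • f)
  have h2 := (h.map f).smul r
  rw [← LinearMap.smul_comp] at h2
  exact h1.unique h2

lemma Hmap_zero : Hmap a i (0 : N →ₗ[R] N') = 0 := by
  have := Hmap_smul (a := a) (i := i) 0 (0 : N →ₗ[R] N')
  simpa using this

lemma Hmap_smul_id (r : R) : Hmap a i (r • LinearMap.id : N →ₗ[R] N) = r • LinearMap.id := by
  rw [Hmap_smul, Hmap_id]

lemma exact_mid {f : N' →ₗ[R] N} {g : N →ₗ[R] N''} (hf : Function.Injective f)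
    (hfg : Function.Exact f g) (hg : Function.Surjective g) (i : ℕ) :
    Function.Exact (Hmap a i f) (Hmap a i g) := by
  intro h
  constructor
  · intro hh
    obtain ⟨t, φ, hφ⟩ := RepH.ex h
    have h0 := hφ.map g
    rw [hh] at h0
    obtain ⟨s, hs, ψ, hφ', e⟩ : ∃ s, ∃ hs : t ≤ s, ∃ φ' : Q a s i →ₗ[R] N, RepH a i s φ' h ∧ g ∘ₗ φ' = 0 := by
      cases i with
      | zero =>
        obtain ⟨s, hs, e⟩ := h0.zero_zero
        exact ⟨s, hs, _, hφ.tr hs, e⟩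
      | succ i =>
        obtain ⟨s, hs, ψ, e⟩ := h0.zero_succ
        obtain ⟨ψ', rfl⟩ := Module.projective_lifting_property g ψ hg
        refine ⟨s, hs, φ ∘ₗ tr a hs (i+1) - ψ' ∘ₗ dQ a s i, ?_, ?_⟩
        · simpa using (hφ.tr hs).sub (RepH.of_bdry ψ')
        · rw [LinearMap.comp_sub, ← LinearMap.comp_assoc, ← e, LinearMap.comp_assoc, sub_self]
    obtain ⟨χ, rfl⟩ := factor hf hfg ψ e
    have hc : χ ∘ₗ dQ a s i = 0 := by
      ext x; apply hf
      simpa using LinearMap.congr_fun hφ'.closed x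
    obtain ⟨h', hh'⟩ := RepH.of_closed hc
    exact ⟨h', (hh'.map f).unique hφ'⟩
  · rintro ⟨h', rfl⟩
    have : g ∘ₗ f = 0 := hfg.linearMap_comp_eq_zero
    rw [← LinearMap.comp_apply, ← Hmap_comp, this, Hmap_zero]; rfl

lemma inj_zero {f : N' →ₗ[R] N} (hf : Function.Injective f) : Function.Injective (Hmap a 0 f) := by
  rw [injective_iff_map_eq_zero]
  intro h hh
  obtain ⟨t, φ, hφ⟩ := RepH.ex h
  have h0 := hφ.map f
  rw [hh] at h0
  obtain ⟨s, hs, e⟩ := h0.zero_zero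
  have : φ ∘ₗ tr a hs 0 = 0 := by
    ext x; apply hf; simpa using LinearMap.congr_fun e x
  have h1 := hφ.tr hs
  rw [this] at h1
  have h2 := h1.smul 0
  rw [zero_smul, zero_smul] at h2
  exact h1.unique h2

lemma exists_delta {f : N' →ₗ[R] N} {g : N →ₗ[R] N''} (hf : Function.Injective f)
    (hfg : Function.Exact f g) (hg : Function.Surjective g) (i : ℕ) :
    ∃ δ : H a i N'' →ₗ[R] H a (i+1) N', Function.Exact (Hmap a i g) δ ∧
      Function.Exact δ (Hmap a (i+1) f) := by
  let G : H a i N'' → H a (i+1) N' → Prop := fun h h' =>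
    ∃ t, ∃ (φ : Q a t i →ₗ[R] N) (ψ : Q a t (i+1) →ₗ[R] N'), f ∘ₗ ψ = φ ∘ₗ dQ a t i ∧
      RepH a i t (g ∘ₗ φ) h ∧ RepH a (i+1) t ψ h'
  have htr : ∀ {t s : ℕ} (hs : t ≤ s) {φ : Q a t i →ₗ[R] N} {ψ : Q a t (i+1) →ₗ[R] N'},
      f ∘ₗ ψ = φ ∘ₗ dQ a t i → f ∘ₗ (ψ ∘ₗ tr a hs (i+1)) = (φ ∘ₗ tr a hs i) ∘ₗ dQ a s i := by
    intro t s hs φ ψ h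
    rw [← LinearMap.comp_assoc, h, LinearMap.comp_assoc, LinearMap.comp_assoc, tr_d]
  have key : ∀ h', G 0 h' → h' = 0 := by
    rintro h' ⟨t, φ, ψ, e, h1, h2⟩
    obtain ⟨s, hs, φ', ψ', e', h1', h2'⟩ : ∃ s, ∃ hs : t ≤ s, ∃ (φ : Q a s i →ₗ[R] N) (ψ : Q a s (i+1) →ₗ[R] N'), f ∘ₗ ψ = φ ∘ₗ dQ a s i ∧ g ∘ₗ φ = 0 ∧ RepH a (i+1) s ψ h' := by
      cases i with
      | zero =>
        obtain ⟨s, hs, e'⟩ := h1.zero_zero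
        exact ⟨s, hs, _, _, htr hs e, e', h2.tr hs⟩
      | succ i =>
        obtain ⟨s, hs, χ, e'⟩ := h1.zero_succ
        obtain ⟨χ', rfl⟩ := Module.projective_lifting_property g χ hg
        refine ⟨s, hs, φ ∘ₗ tr a hs (i+1) - χ' ∘ₗ dQ a s i, _, ?_, ?_, h2.tr hs⟩
        · rw [htr hs e, LinearMap.sub_comp, LinearMap.comp_assoc _ _ χ', dQ_dQ]; simp
        · rw [LinearMap.comp_sub, ← LinearMap.comp_assoc, ← e', LinearMap.comp_assoc, sub_self]
    obtain ⟨χ, rfl⟩ := factor hf hfg φ' h1'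
    have : ψ' = χ ∘ₗ dQ a s i := by
      ext x; apply hf; simpa using LinearMap.congr_fun e' x
    subst this
    exact h2'.unique (RepH.of_bdry χ)
  have hG : ∃ δ : H a i N'' →ₗ[R] H a (i+1) N', ∀ x y, G x y ↔ δ x = y := by
    refine exists_linear_of_graph (R := R) G ?_ ?_ ?_ key
    · rintro x x' y y' ⟨t, φ, ψ, e, h1, h2⟩ ⟨t', φ', ψ', e', h1', h2'⟩
      refine ⟨max t t', φ ∘ₗ tr a (le_max_left t t') i + φ' ∘ₗ tr a (le_max_right t t') i, _ + _, ?_, ?_, (h2.tr (le_max_left t t')).add (h2'.tr (le_max_right t t'))⟩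
      · rw [LinearMap.comp_add, LinearMap.add_comp, htr _ e, htr _ e']
      · rw [LinearMap.comp_add]
        exact (h1.tr (le_max_left t t')).add (h1'.tr (le_max_right t t'))
    · rintro r x y ⟨t, φ, ψ, e, h1, h2⟩
      refine ⟨t, r • φ, r • ψ, ?_, ?_, h2.smul r⟩
      · rw [LinearMap.comp_smul, e, LinearMap.smul_comp]
      · rw [LinearMap.comp_smul]; exact h1.smul r
    · intro h
      obtain ⟨t, φ, h1⟩ := RepH.ex h
      obtain ⟨φ', rfl⟩ := Module.projective_lifting_property g φ hg
      obtain ⟨ψ, e⟩ := factor hf hfg (φ' ∘ₗ dQ a t i) h1.closed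
      have hc : ψ ∘ₗ dQ a t (i+1) = 0 := by
        ext x; apply hf
        have := LinearMap.congr_fun e (dQ a t (i+1) x)
        have h2 := LinearMap.congr_fun (dQ_dQ a t i) x
        simp only [LinearMap.comp_apply] at this h2 ⊢
        rw [this, h2]; simp
      obtain ⟨h', hh'⟩ := RepH.of_closed hc
      exact ⟨h', t, φ', ψ, e, h1, hh'⟩
  obtain ⟨δ, hδ⟩ := hG
  · refine ⟨δ, ?_, ?_⟩
    · intro h
      constructor
      · intro hh
        obtain ⟨t, φ, ψ, e, h1, h2⟩ := (hδ _ _).2 hh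
        obtain ⟨s, hs, χ, e'⟩ := h2.zero_succ
        have hc : (φ ∘ₗ tr a hs i - f ∘ₗ χ) ∘ₗ dQ a s i = 0 := by
          rw [LinearMap.sub_comp, LinearMap.comp_assoc _ _ f, e', htr hs e, sub_self]
        obtain ⟨h', hh'⟩ := RepH.of_closed hc
        refine ⟨h', (hh'.map g).unique ?_⟩
        have := h1.tr hs
        convert this using 1
        have : g ∘ₗ f = 0 := hfg.linearMap_comp_eq_zero
        rw [LinearMap.comp_sub, ← LinearMap.comp_assoc, ← LinearMap.comp_assoc, this]; simp
      · rintro ⟨h', rfl⟩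
        obtain ⟨t, φ, h1⟩ := RepH.ex h'
        refine (hδ _ _).1 ⟨t, φ, 0, ?_, h1.map g, ?_⟩
        · rw [h1.closed]; simp
        · simpa using RepH.of_bdry (0 : Q a t i →ₗ[R] N')
    · intro h
      constructor
      · intro hh
        obtain ⟨t, φ, h1⟩ := RepH.ex h
        have h2 := h1.map f
        rw [hh] at h2
        obtain ⟨s, hs, χ, e⟩ := h2.zero_succ
        have hc : (g ∘ₗ χ) ∘ₗ dQ a s i = 0 := by
          have : g ∘ₗ f = 0 := hfg.linearMap_comp_eq_zero
          rw [LinearMap.comp_assoc, e, ← LinearMap.comp_assoc, ← LinearMap.comp_assoc, this]; simp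
        obtain ⟨h', hh'⟩ := RepH.of_closed hc
        exact ⟨h', (hδ _ _).1 ⟨s, χ, _, e.symm, hh', h1.tr hs⟩⟩
      · rintro ⟨h', rfl⟩
        obtain ⟨t, φ, ψ, e, h1, h2⟩ := (hδ h' _).2 rfl
        have := h2.map f
        rw [e] at this
        exact this.unique (RepH.of_bdry φ)

lemma torsion_aux {φ : Q a t i →ₗ[R] N} {h} (H : RepH a i t φ h) {x : R} (hx : x ∈ a ^ t) :
    x • h = 0 := by
  obtain ⟨e, h1, rfl⟩ := H
  have c1 : (x • 𝟙 (PR a t).complex).f 0 ≫ (PR a t).π.f 0 = (PR a t).π.f 0 ≫ 0 := by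
    rw [comp_zero]
    ext q
    obtain ⟨r, hr⟩ := Ideal.Quotient.mk_surjective (I := a ^ t) (((PR a t).π.f 0).hom q)
    have : ((PR a t).π.f 0).hom (x • q) = x • (((PR a t).π.f 0).hom q) := map_smul _ _ _
    refine this.trans ?_
    rw [← hr]
    change Ideal.Quotient.mk (a ^ t) (x * r) = 0
    exact Ideal.Quotient.eq_zero_iff_mem.2 (Ideal.mul_mem_right _ _ hx)
  have c2 : (0 : (PR a t).complex ⟶ (PR a t).complex).f 0 ≫ (PR a t).π.f 0 = (PR a t).π.f 0 ≫ 0 := by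
    rw [comp_zero]; exact zero_comp
  have h2 := h1.mapX (P' := PR a t) _ _ c1
  have h3 := h1.mapX (P' := PR a t) _ _ c2
  have h4 := h3.smul (0 : R)
  have e1 : (0 : R) • ((0 : (PR a t).complex ⟶ (PR a t).complex).f i ≫ ModuleCat.ofHom φ) =
    (0 : (PR a t).complex ⟶ (PR a t).complex).f i ≫ ModuleCat.ofHom φ := by simp
  rw [e1] at h4
  rw [h3.unique h4, zero_smul] at h2
  have h5 := h1.smul x
  have e2 : (x • 𝟙 (PR a t).complex).f i ≫ ModuleCat.ofHom φ = x • ModuleCat.ofHom φ := by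
    simp
  rw [e2] at h2
  rw [← map_smul, h5.unique h2, map_zero]

lemma torsion (h : H a i N) : ∃ t, ∀ x ∈ a ^ t, x • h = 0 := by
  obtain ⟨t, φ, h1⟩ := RepH.ex h
  exact ⟨t, fun x hx => torsion_aux h1 hx⟩

lemma dQ_exact (a : Ideal R) (t i : ℕ) : Function.Exact (dQ a t (i+1)) (dQ a t i) := by
  have := (PR a t).exact_succ i
  exact (ShortComplex.ShortExact.moduleCat_exact_iff_function_exact _).1 this

lemma H_inj [Module.Injective R N] (i : ℕ) : Subsingleton (H a (i+1) N) := by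
  refine subsingleton_of_forall_eq 0 fun h => ?_
  obtain ⟨t, φ, h1⟩ := RepH.ex h
  obtain ⟨ψ, rfl⟩ : ∃ ψ : Q a t i →ₗ[R] N, ψ ∘ₗ dQ a t i = φ := by
    have hk : LinearMap.ker (dQ a t i) ≤ LinearMap.ker φ := by
      intro x hx
      obtain ⟨y, rfl⟩ := (dQ_exact a t i x).1 hx
      exact LinearMap.congr_fun h1.closed y
    let φ' := (LinearMap.ker (dQ a t i)).liftQ φ hk
    let j := (LinearMap.ker (dQ a t i)).liftQ (dQ a t i) le_rfl
    have hj : Function.Injective j := LinearMap.ker_eq_bot.1 (Submodule.ker_liftQ_eq_bot' _ _ rfl)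
    obtain ⟨ψ, hψ⟩ := Module.Injective.out j hj φ'
    refine ⟨ψ, ?_⟩
    ext x
    exact hψ (Submodule.Quotient.mk x)
  exact h1.unique (RepH.of_bdry ψ)

/-- augmentation -/
noncomputable def aug (a : Ideal R) (t : ℕ) : Q a t 0 →ₗ[R] R ⧸ a ^ t := ((PR a t).π.f 0).hom

lemma aug_surj (a : Ideal R) (t : ℕ) : Function.Surjective (aug a t) :=
  (ModuleCat.epi_iff_surjective _).1 (inferInstanceAs (Epi ((PR a t).π.f 0)))

lemma aug_exact (a : Ideal R) (t : ℕ) : Function.Exact (dQ a t 0) (aug a t) := by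
  have := (PR a t).exact₀
  exact (ShortComplex.ShortExact.moduleCat_exact_iff_function_exact _).1 this

lemma exists_ev : ∃ ev : H a 0 N →ₗ[R] N, Function.Injective ev ∧
    (∀ n, (∃ h, ev h = n) ↔ ∃ t, ∀ x ∈ a ^ t, x • n = 0) ∧
    ∀ h t (φ : Q a t 0 →ₗ[R] N), RepH a 0 t φ h → ∀ q, aug a t q = Ideal.Quotient.mk _ 1 →
      φ q = ev h := by
  let G : H a 0 N → N → Prop := fun h n => ∃ t, ∃ φ : Q a t 0 →ₗ[R] N, RepH a 0 t φ h ∧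
    ∀ q r, aug a t q = Ideal.Quotient.mk _ r → φ q = r • n
  have htr : ∀ {t s} (hs : t ≤ s) {φ : Q a t 0 →ₗ[R] N} {n : N}, (∀ q r, aug a t q = Ideal.Quotient.mk _ r → φ q = r • n) →
      ∀ q r, aug a s q = Ideal.Quotient.mk _ r → (φ ∘ₗ tr a hs 0) q = r • n := by
    intro t s hs φ n h q r e
    refine h _ r ?_
    have := congrArg (fun k => k.hom q) (tr_comm (a := a) hs)
    refine this.trans ?_
    change (qmap a hs).hom (aug a s q) = _
    rw [e]; rfl
  have hex : ∀ t n, (∀ x ∈ a ^ t, x • n = 0) → ∃ (φ : Q a t 0 →ₗ[R] N) (h : _), RepH a 0 t φ h ∧ 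
      ∀ q r, aug a t q = Ideal.Quotient.mk _ r → φ q = r • n := by
    intro t n hn
    let φ : Q a t 0 →ₗ[R] N := (Submodule.liftQ (a ^ t) (LinearMap.toSpanSingleton R N n) (fun x hx => hn x hx)) ∘ₗ aug a t
    have hc : φ ∘ₗ dQ a t 0 = 0 := by
      rw [LinearMap.comp_assoc, (aug_exact a t).linearMap_comp_eq_zero, LinearMap.comp_zero]
    obtain ⟨h, hh⟩ := RepH.of_closed hc
    refine ⟨φ, h, hh, fun q r e => ?_⟩
    simp only [φ, LinearMap.comp_apply]
    rw [e]
    exact Submodule.liftQ_apply _ _ _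
  have hval : ∀ t (φ : Q a t 0 →ₗ[R] N) h, RepH a 0 t φ h → ∀ q₁, aug a t q₁ = Ideal.Quotient.mk _ 1 →
      ∀ q r, aug a t q = Ideal.Quotient.mk _ r → φ q = r • φ q₁ := by
    intro t φ h h1 q₁ hq₁ q r e
    have : aug a t (q - r • q₁) = 0 := by
      rw [map_sub, map_smul, hq₁, e]
      change Ideal.Quotient.mk _ r - Ideal.Quotient.mk _ (r * 1) = 0
      simp
    obtain ⟨z, hz⟩ := (aug_exact a t _).1 this
    have h3 := LinearMap.congr_fun h1.closed z
    rw [LinearMap.comp_apply, hz, map_sub, map_smul] at h3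
    exact sub_eq_zero.1 h3
  have hG : ∃ δ : H a 0 N →ₗ[R] N, ∀ x y, G x y ↔ δ x = y := by
    refine exists_linear_of_graph (R := R) G ?_ ?_ ?_ ?_
    · rintro x x' y y' ⟨t, φ, h1, h2⟩ ⟨t', φ', h1', h2'⟩
      refine ⟨max t t', _, (h1.tr (le_max_left t t')).add (h1'.tr (le_max_right t t')), ?_⟩
      intro q r e
      rw [LinearMap.add_apply, htr _ h2 q r e, htr _ h2' q r e, smul_add]
    · rintro c x y ⟨t, φ, h1, h2⟩
      refine ⟨t, _, h1.smul c, fun q r e => ?_⟩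
      rw [LinearMap.smul_apply, h2 q r e, smul_comm]
    · intro h
      obtain ⟨t, φ, h1⟩ := RepH.ex h
      obtain ⟨q₁, hq₁⟩ := aug_surj a t (Ideal.Quotient.mk _ 1)
      exact ⟨φ q₁, t, φ, h1, hval t φ h h1 q₁ hq₁⟩
    · rintro n ⟨t, φ, h1, h2⟩
      obtain ⟨s, hs, e⟩ := h1.zero_zero
      obtain ⟨q₁, hq₁⟩ := aug_surj a s (Ideal.Quotient.mk _ 1)
      have := htr hs h2 q₁ 1 hq₁
      rw [e] at this
      simpa using this.symm
  obtain ⟨ev, hev⟩ := hG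
  · refine ⟨ev, ?_, ?_, fun h t φ h1 q hq => ((hev _ _).1 ⟨t, φ, h1, hval t φ h h1 q hq⟩).symm⟩
    · rw [injective_iff_map_eq_zero]
      intro h hh
      obtain ⟨t, φ, h1, h2⟩ := (hev _ _).2 hh
      have : φ = 0 := by
        ext q
        obtain ⟨r, hr⟩ := Ideal.Quotient.mk_surjective (aug a t q)
        simpa using h2 q r hr.symm
      subst this
      have := h1.smul 0
      rw [zero_smul, zero_smul] at this
      exact h1.unique this
    · intro n
      constructor
      · rintro ⟨h, hh⟩
        obtain ⟨t, φ, h1, h2⟩ := (hev _ _).2 hh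
        refine ⟨t, fun x hx => ?_⟩
        have := h2 0 x (by rw [map_zero, Ideal.Quotient.eq_zero_iff_mem.2 hx])
        rw [← this, map_zero]
      · rintro ⟨t, ht⟩
        obtain ⟨φ, h, h1, h2⟩ := hex t n ht
        exact ⟨h, (hev _ _).1 ⟨t, φ, h1, h2⟩⟩

/-- evaluation -/
noncomputable def ev (a : Ideal R) (N : Type u) [AddCommGroup N] [Module R N] : H a 0 N →ₗ[R] N :=
  (exists_ev (a := a) (N := N)).choose

lemma ev_inj : Function.Injective (ev a N) := (exists_ev (a := a) (N := N)).choose_spec.1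

lemma ev_range (n : N) : (∃ h, ev a N h = n) ↔ ∃ t, ∀ x ∈ a ^ t, x • n = 0 :=
  (exists_ev (a := a) (N := N)).choose_spec.2.1 n

lemma ev_nat (f : N →ₗ[R] N') (h : H a 0 N) : ev a N' (Hmap a 0 f h) = f (ev a N h) := by
  obtain ⟨t, φ, h1⟩ := RepH.ex h
  obtain ⟨q₁, hq₁⟩ := aug_surj a t (Ideal.Quotient.mk _ 1)
  have h2 := (exists_ev (a := a) (N := N)).choose_spec.2.2 _ _ _ h1 q₁ hq₁
  have h3 := (exists_ev (a := a) (N := N')).choose_spec.2.2 _ _ _ (h1.map f) q₁ hq₁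
  exact h3.symm.trans (congrArg f h2)

lemma extend_of_ker_le {A B : Type u} [AddCommGroup A] [Module R A] [AddCommGroup B] [Module R B]
    [Module.Injective R N] (g : A →ₗ[R] B) (φ : A →ₗ[R] N)
    (hk : LinearMap.ker g ≤ LinearMap.ker φ) : ∃ ψ : B →ₗ[R] N, ψ ∘ₗ g = φ := by
  let φ' := (LinearMap.ker g).liftQ φ hk
  let j := (LinearMap.ker g).liftQ g le_rfl
  have hj : Function.Injective j := LinearMap.ker_eq_bot.1 (Submodule.ker_liftQ_eq_bot' _ _ rfl)
  obtain ⟨ψ, hψ⟩ := Module.Injective.out j hj φ'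
  refine ⟨ψ, ?_⟩
  ext x
  exact hψ (Submodule.Quotient.mk x)

end
end LC

namespace LC

section
variable {R : Type u} [CommRing R] {a : Ideal R} {i t : ℕ}
variable {N : Type u} [AddCommGroup N] [Module R N] {N' : Type u} [AddCommGroup N'] [Module R N']
  {N'' : Type u} [AddCommGroup N''] [Module R N'']

/-- torsion submodule -/
def Gam (a : Ideal R) (N : Type u) [AddCommGroup N] [Module R N] : Submodule R N where
  carrier := {n | ∃ t, ∀ x ∈ a ^ t, x • n = 0}
  add_mem' := by
    rintro x y ⟨t, ht⟩ ⟨s, hs⟩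
    refine ⟨t + s, fun r hr => ?_⟩
    rw [smul_add, ht r (Ideal.pow_le_pow_right (Nat.le_add_right _ _) hr),
      hs r (Ideal.pow_le_pow_right (Nat.le_add_left _ _) hr), add_zero]
  zero_mem' := ⟨0, by simp⟩
  smul_mem' := by
    rintro c x ⟨t, ht⟩
    exact ⟨t, fun r hr => by rw [smul_comm, ht r hr, smul_zero]⟩

lemma mem_Gam {n : N} : n ∈ Gam a N ↔ ∃ t, ∀ x ∈ a ^ t, x • n = 0 := Iff.rfl

lemma Gam_injective [IsNoetherianRing R] [Module.Injective R N] : Module.Injective R (Gam a N) := by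
  refine Module.Baer.injective fun J f => ?_
  obtain ⟨t, ht⟩ : ∃ t, ∀ x ∈ a ^ t, ∀ y : J, x • f y = 0 := by
    have hfg : (⊤ : Submodule R J).FG := Module.Finite.fg_top
    obtain ⟨S, hS⟩ := hfg
    choose t ht using fun y : J => (f y).2
    refine ⟨S.sup t, fun x hx y => ?_⟩
    have hy : y ∈ Submodule.span R (S : Set J) := by rw [hS]; trivial
    induction hy using Submodule.span_induction with
    | mem y hy =>
      exact Subtype.ext (ht y x (Ideal.pow_le_pow_right (Finset.le_sup (f := t) hy) hx))
    | zero => simp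
    | add y z _ _ h1 h2 => rw [map_add, smul_add, h1, h2, add_zero]
    | smul c y _ h1 => rw [map_smul, smul_comm, h1, smul_zero]
  obtain ⟨k, hk⟩ := Ideal.exists_pow_inf_eq_pow_smul a (J : Submodule R R)
  have h1 := hk (t + k) (by omega)
  have hker : LinearMap.ker ((Submodule.mkQ (a ^ (t + k))) ∘ₗ J.subtype) ≤
      LinearMap.ker ((Gam a N).subtype ∘ₗ f) := by
    intro y hy
    have hy1 : (y : R) ∈ a ^ (t + k) := Ideal.Quotient.eq_zero_iff_mem.1 hy
    have hy2 : (y : R) ∈ a ^ t • (J : Submodule R R) := by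
      have : (y : R) ∈ a ^ (t + k) • (⊤ : Submodule R R) ⊓ J := ⟨by simpa using hy1, y.2⟩
      rw [h1] at this
      exact Submodule.smul_mono (by simp) inf_le_right this
    have hy3 : ∀ z ∈ a ^ t • (J : Submodule R R), ∃ hz : z ∈ J, f ⟨z, hz⟩ = 0 := by
      intro z hz
      induction hz using Submodule.smul_induction_on' with
      | smul r hr w hw =>
        refine ⟨J.smul_mem r hw, ?_⟩
        have : (⟨r • w, J.smul_mem r hw⟩ : J) = r • ⟨w, hw⟩ := rfl
        rw [this, map_smul, ht r hr]
      | add u hu v hv h1 h2 =>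
        obtain ⟨p, hp⟩ := h1
        obtain ⟨q, hq⟩ := h2
        refine ⟨J.add_mem p q, ?_⟩
        have : (⟨u + v, J.add_mem p q⟩ : J) = ⟨u, p⟩ + ⟨v, q⟩ := rfl
        rw [this, map_add, hp, hq, add_zero]
    obtain ⟨_, h⟩ := hy3 _ hy2
    simpa using h
  obtain ⟨ψ, hψ⟩ := extend_of_ker_le _ _ hker
  have hmem : ∀ z, ψ z ∈ Gam a N := by
    intro z
    refine ⟨t + k, fun x hx => ?_⟩
    obtain ⟨r, rfl⟩ := Submodule.Quotient.mk_surjective _ z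
    rw [← map_smul, ← Submodule.Quotient.mk_smul, (Submodule.Quotient.mk_eq_zero _).2, map_zero]
    exact Ideal.mul_mem_right _ _ hx
  refine ⟨(ψ.codRestrict _ hmem) ∘ₗ Submodule.mkQ _, fun x hx => Subtype.ext ?_⟩
  exact LinearMap.congr_fun hψ ⟨x, hx⟩

lemma exists_injective_embedding (N : Type u) [AddCommGroup N] [Module R N] :
    ∃ (I : Type u) (_ : AddCommGroup I) (_ : Module R I), Module.Injective R I ∧
      ∃ f : N →ₗ[R] I, Function.Injective f := by
  have hi : Module.Injective R ((Injective.under (ModuleCat.of R N) : ModuleCat.{u} R) : Type u) :=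
    (Module.injective_iff_injective_object R _).2 (Injective.injective_under _)
  exact ⟨((Injective.under (ModuleCat.of R N) : ModuleCat.{u} R) : Type u), inferInstance, inferInstance, hi,
    (Injective.ι (ModuleCat.of R N)).hom, (ModuleCat.mono_iff_injective _).1 inferInstance⟩

lemma tors_vanish [IsNoetherianRing R] (i : ℕ) : ∀ (N : Type u) [AddCommGroup N] [Module R N],
    (∀ n : N, n ∈ Gam a N) → Subsingleton (H a (i+1) N) := by
  induction i with
  | zero =>
    intro N _ _ hN
    obtain ⟨I, _, _, hI, f, hf⟩ := exists_injective_embedding (R := R) N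
    have hmem : ∀ n, f n ∈ Gam a I := fun n => by
      obtain ⟨t, ht⟩ := hN n
      exact ⟨t, fun x hx => by rw [← map_smul, ht x hx, map_zero]⟩
    let g : N →ₗ[R] Gam a I := f.codRestrict _ hmem
    have hg : Function.Injective g := fun x y h => hf (congrArg Subtype.val h)
    have hI' := Gam_injective (a := a) (R := R) (N := I)
    have hex : Function.Exact g (LinearMap.range g).mkQ := LinearMap.exact_map_mkQ_range g
    obtain ⟨δ, h1, h2⟩ := exists_delta (a := a) hg hex (Submodule.mkQ_surjective _) 0
    have := H_inj (a := a) (N := Gam a I) 0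
    refine subsingleton_of_forall_eq 0 fun h => ?_
    obtain ⟨y, rfl⟩ := (h2 h).1 (Subsingleton.elim _ _)
    rw [h1]
    obtain ⟨e, he⟩ := Submodule.mkQ_surjective _ (ev _ _ y)
    obtain ⟨t, ht⟩ := e.2
    obtain ⟨w, hw⟩ := (ev_range (a := a) e).2 ⟨t, fun x hx => Subtype.ext (ht x hx)⟩
    refine ⟨w, ev_inj ?_⟩
    rw [ev_nat, hw, he]
  | succ i ih =>
    intro N _ _ hN
    obtain ⟨I, _, _, hI, f, hf⟩ := exists_injective_embedding (R := R) N
    have hmem : ∀ n, f n ∈ Gam a I := fun n => by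
      obtain ⟨t, ht⟩ := hN n
      exact ⟨t, fun x hx => by rw [← map_smul, ht x hx, map_zero]⟩
    let g : N →ₗ[R] Gam a I := f.codRestrict _ hmem
    have hg : Function.Injective g := fun x y h => hf (congrArg Subtype.val h)
    have hI' := Gam_injective (a := a) (R := R) (N := I)
    have hex : Function.Exact g (LinearMap.range g).mkQ := LinearMap.exact_map_mkQ_range g
    obtain ⟨δ, h1, h2⟩ := exists_delta (a := a) hg hex (Submodule.mkQ_surjective _) (i+1)
    have := H_inj (a := a) (N := Gam a I) (i+1)
    have := ih (Gam a I ⧸ LinearMap.range g) (by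
      intro n
      obtain ⟨e, rfl⟩ := Submodule.mkQ_surjective _ n
      obtain ⟨t, ht⟩ := e.2
      exact ⟨t, fun x hx => by
        have h0 : x • e = 0 := Subtype.ext (ht x hx)
        rw [← map_smul, h0, map_zero]⟩)
    refine subsingleton_of_forall_eq 0 fun h => ?_
    obtain ⟨y, rfl⟩ := (h2 h).1 (Subsingleton.elim _ _)
    rw [Subsingleton.elim y 0, map_zero]

/-- `H^0` of torsion module. -/
lemma tors_H0 (hN : ∀ n : N, n ∈ Gam a N) : Function.Bijective (ev a N) :=
  ⟨ev_inj, fun n => (ev_range n).2 (hN n)⟩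

lemma H0_zero (hN : Gam a N = ⊥) : Subsingleton (H a 0 N) := by
  refine subsingleton_of_forall_eq 0 fun h => ev_inj ?_
  have : ev a N h ∈ Gam a N := (ev_range _).1 ⟨h, rfl⟩
  rw [hN] at this
  rw [map_zero]; exact this

lemma Gam_quot (a : Ideal R) (N : Type u) [AddCommGroup N] [Module R N] (ha : a.FG) : Gam a (N ⧸ Gam a N) = ⊥ := by
  rw [eq_bot_iff]
  intro y hy
  obtain ⟨n, rfl⟩ := Submodule.mkQ_surjective _ y
  obtain ⟨t, ht⟩ := hy
  have h2 : ∀ x ∈ a ^ t, x • n ∈ Gam a N := by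
    intro x hx
    have := ht x hx
    rw [← map_smul] at this
    exact (Submodule.Quotient.mk_eq_zero _).1 this
  obtain ⟨S, hS⟩ := ha.pow (n := t)
  choose! s hs using h2
  rw [Submodule.mem_bot, Submodule.mkQ_apply, Submodule.Quotient.mk_eq_zero]
  refine ⟨S.sup s + t, fun x hx => ?_⟩
  rw [pow_add] at hx
  induction hx using Submodule.mul_induction_on' with
  | mem_mul_mem r hr x hx =>
    rw [← hS] at hx
    induction hx using Submodule.span_induction with
    | mem x hx =>
      have hx' : x ∈ a ^ t := by rw [← hS]; exact Ideal.subset_span hx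
      rw [mul_smul]
      exact hs x hx' r (Ideal.pow_le_pow_right (Finset.le_sup (f := s) hx) hr)
    | zero => simp
    | add y z _ _ h1 h2 => rw [mul_add, add_smul, h1, h2, add_zero]
    | smul c y _ h1 => rw [smul_eq_mul, mul_left_comm, mul_smul, h1, smul_zero]
  | add y _ z _ h1 h2 => rw [add_smul, h1, h2, add_zero]

lemma Hmap_bij_of_ker_tors [IsNoetherianRing R] {g : N →ₗ[R] N'} (hg : Function.Surjective g)
    (hk : ∀ n ∈ LinearMap.ker g, n ∈ Gam a N) (i : ℕ) : Function.Bijective (Hmap a (i+1) g) := by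
  have hk' : ∀ n : LinearMap.ker g, n ∈ Gam a (LinearMap.ker g) := fun n => by
    obtain ⟨t, ht⟩ := hk n n.2
    exact ⟨t, fun x hx => Subtype.ext (ht x hx)⟩
  have hex : Function.Exact (LinearMap.ker g).subtype g := LinearMap.exact_subtype_ker_map g
  have h1 := tors_vanish (a := a) i _ hk'
  have h2 := tors_vanish (a := a) (i+1) _ hk'
  have e1 := exact_mid (a := a) (Submodule.injective_subtype _) hex hg (i+1)
  obtain ⟨δ, e2, e3⟩ := exists_delta (a := a) (Submodule.injective_subtype _) hex hg (i+1)
  constructor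
  · rw [injective_iff_map_eq_zero]
    intro h hh
    obtain ⟨y, rfl⟩ := (e1 h).1 hh
    rw [Subsingleton.elim y 0, map_zero]
  · intro h
    exact (e2 h).1 (Subsingleton.elim _ _)

open scoped Pointwise in
lemma exists_delta_reg {x : R} (hx : ∀ n : N, x • n = 0 → n = 0) (i : ℕ) :
    ∃ δ : H a i (QuotSMulTop x N) →ₗ[R] H a (i+1) N, ∀ h, x • h = 0 ↔ ∃ y, δ y = h := by
  have hf : Function.Injective (x • LinearMap.id : N →ₗ[R] N) := by
    rw [injective_iff_map_eq_zero]; exact fun n hn => hx n hn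
  have hex : Function.Exact (x • LinearMap.id : N →ₗ[R] N) (Submodule.mkQ (x • (⊤ : Submodule R N))) := by
    intro n
    rw [Submodule.mkQ_apply, Submodule.Quotient.mk_eq_zero, Submodule.mem_smul_pointwise_iff_exists]
    simp
  obtain ⟨δ, e2, e3⟩ := exists_delta (a := a) hf hex (Submodule.mkQ_surjective _) i
  refine ⟨δ, fun h => ?_⟩
  rw [← Set.mem_range, ← e3 h, Hmap_smul_id]; rfl

lemma H_surj_of_vanish {g : N →ₗ[R] N'} (hg : Function.Surjective g) (i : ℕ)
    (h : Subsingleton (H a (i+1) (LinearMap.ker g))) : Function.Surjective (Hmap a i g) := by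
  have hex : Function.Exact (LinearMap.ker g).subtype g := LinearMap.exact_subtype_ker_map g
  obtain ⟨δ, e2, e3⟩ := exists_delta (a := a) (Submodule.injective_subtype _) hex hg i
  intro y
  exact (e2 y).1 (Subsingleton.elim _ _)

/-- transport along equivalences -/
noncomputable def Hequiv (a : Ideal R) (i : ℕ) (e : N ≃ₗ[R] N') : H a i N ≃ₗ[R] H a i N' :=
  LinearEquiv.ofLinearMap (Hmap a i e.toLinearMap) (Hmap a i e.symm.toLinearMap)
    (by rw [← Hmap_comp]; simp [Hmap_id]) (by rw [← Hmap_comp]; simp [Hmap_id])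

lemma H_zero [Subsingleton N] : Subsingleton (H a i N) := by
  refine subsingleton_of_forall_eq 0 fun h => ?_
  have : (LinearMap.id : N →ₗ[R] N) = 0 := by ext x; exact Subsingleton.elim _ _
  have h2 := Hmap_id (a := a) i (N := N)
  rw [this, Hmap_zero] at h2
  exact (LinearMap.congr_fun h2 h).symm

end
end LC

namespace LC

section
variable {A : Type u} [CommRing A] {a : Ideal A}
variable {N : Type u} [AddCommGroup N] [Module A N] {N' : Type u} [AddCommGroup N'] [Module A N']

lemma H_zero_of_inv {x : A} (hx : x ∈ a) (g : N →ₗ[A] N) (hg : x • g = LinearMap.id) (i : ℕ) :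
    Subsingleton (H a i N) := by
  refine subsingleton_of_forall_eq 0 fun h => ?_
  have key : ∀ h : H a i N, x • h = 0 → h = 0 := by
    intro h hh
    have h2 := Hmap_id (a := a) i (N := N)
    rw [← hg, Hmap_smul] at h2
    have h3 := LinearMap.congr_fun h2 h
    rw [LinearMap.smul_apply, ← map_smul, hh, map_zero] at h3
    exact h3.symm
  obtain ⟨t, ht⟩ := torsion h
  have := ht (x ^ t) (Ideal.pow_mem_pow hx t)
  clear ht
  induction t with
  | zero => simpa using this
  | succ t ih =>
    apply ih
    apply key
    rw [← mul_smul, ← pow_succ']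
    exact this

lemma Gam_map (f : N →ₗ[A] N') {n : N} (h : n ∈ Gam a N) : f n ∈ Gam a N' := by
  obtain ⟨t, ht⟩ := h
  exact ⟨t, fun x hx => by rw [← map_smul, ht x hx, map_zero]⟩

lemma Gam_sup {b : Ideal A} {n : N} (h : n ∈ Gam a N) (h' : n ∈ Gam b N) : n ∈ Gam (a ⊔ b) N := by
  obtain ⟨t, ht⟩ := h
  obtain ⟨s, hs⟩ := h'
  refine ⟨t + s, fun x hx => ?_⟩
  have := Ideal.sup_pow_add_le_pow_sup_pow hx
  obtain ⟨y, hy, z, hz, rfl⟩ := Submodule.mem_sup.1 this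
  rw [add_smul, ht y hy, hs z hz, add_zero]

lemma Gam_span_singleton {x : A} {n : N} {k : ℕ} (h : x ^ k • n = 0) : n ∈ Gam (Ideal.span {x}) N := by
  refine ⟨k, fun y hy => ?_⟩
  rw [Ideal.span_singleton_pow, Ideal.mem_span_singleton'] at hy
  obtain ⟨c, rfl⟩ := hy
  rw [mul_smul, h, smul_zero]

lemma Gam_mono {b : Ideal A} {n : N} (hb : b.FG) (hab : b ≤ a.radical) (h : n ∈ Gam a N) : n ∈ Gam b N := by
  obtain ⟨t, ht⟩ := h
  obtain ⟨k, hk⟩ := Ideal.exists_pow_le_of_le_radical_of_fg hab hb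
  refine ⟨k * t, fun x hx => ht x ?_⟩
  rw [pow_mul] at hx
  exact Ideal.pow_right_mono hk t hx

variable {R : Type u} [CommRing R] [Algebra R A]

/-- `R_x / R`. -/
abbrev Cx (x : R) : Type u := Localization.Away x ⧸ LinearMap.range (Algebra.linearMap R (Localization.Away x))

/-- iterated tensor -/
noncomputable def Cmod : List R → ModuleCat.{u} R
  | [] => ModuleCat.of R R
  | x :: l => ModuleCat.of R (TensorProduct R (Cx x) (Cmod l))

open TensorProduct

theorem comp [IsNoetherianRing A] (a : Ideal A) (l : List R) :
    ∀ (J : Ideal A) (_ : ∀ x ∈ l, algebraMap R A x ∈ a) (_ : a ≤ (J ⊔ Ideal.span {y | ∃ x ∈ l, algebraMap R A x = y}).radical)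
      (N : Type u) [AddCommGroup N] [Module A N] [Module R N] [IsScalarTower R A N]
      (_ : ∀ n : N, n ∈ Gam J N), (∀ i, l.length < i → Subsingleton (H a i N)) ∧
        Nonempty (H a l.length N ≃ₗ[A] N ⊗[R] (Cmod l : Type u)) := by
  induction l with
  | nil =>
    intro J _ hJ N _ _ _ _ hN
    have hN' : ∀ n : N, n ∈ Gam a N := fun n => Gam_mono (IsNoetherian.noetherian a)
      (by simpa using hJ) (hN n)
    constructor
    · intro i hi
      obtain ⟨i, rfl⟩ := Nat.exists_eq_succ_of_ne_zero (Nat.pos_iff_ne_zero.1 hi)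
      exact tors_vanish i N hN'
    · exact ⟨(LinearEquiv.ofBijective _ (tors_H0 hN')) ≪≫ₗ (TensorProduct.AlgebraTensorModule.rid R A N).symm⟩
  | cons x l ih =>
    intro J hl hJ N _ _ _ _ hN
    set x' := algebraMap R A x with hx'
    have hxa : x' ∈ a := hl x (by simp)
    let f : N →ₗ[A] N ⊗[R] Localization.Away x :=
      (TensorProduct.AlgebraTensorModule.map (LinearMap.id : N →ₗ[A] N) (Algebra.linearMap R (Localization.Away x)))
        ∘ₗ (TensorProduct.AlgebraTensorModule.rid R A N).symm.toLinearMap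
    let q : N ⊗[R] Localization.Away x →ₗ[A] N ⊗[R] (Cx x) :=
      TensorProduct.AlgebraTensorModule.map (LinearMap.id : N →ₗ[A] N) (Submodule.mkQ _)
    have hf : ∀ n, f n = n ⊗ₜ 1 := fun n => by simp [f]
    have hq : Function.Surjective q :=
      LinearMap.lTensor_surjective N (Submodule.mkQ_surjective (LinearMap.range (Algebra.linearMap R (Localization.Away x))))
    have hfq : Function.Exact f q := by
      have h1 := lTensor_exact N (LinearMap.exact_map_mkQ_range (Algebra.linearMap R (Localization.Away x)))
        (Submodule.mkQ_surjective _)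
      intro y
      refine (h1 y).trans ?_
      constructor
      · rintro ⟨z, rfl⟩
        refine ⟨TensorProduct.rid R N z, ?_⟩
        induction z using TensorProduct.induction_on with
        | zero => simp
        | add _ _ h1 h2 => rw [map_add, map_add, h1, h2, map_add]
        | tmul n c => simp [hf, TensorProduct.smul_tmul, Algebra.algebraMap_eq_smul_one]
      · rintro ⟨n, rfl⟩
        exact ⟨n ⊗ₜ 1, by rw [hf]; simp⟩
    have hkerx : ∀ n, f n = 0 → ∃ k : ℕ, x' ^ k • n = 0 := by
      intro n hn
      rw [hf] at hn
      have h1 : TensorProduct.mk R (Localization.Away x) N 1 n = 0 := by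
        have := congrArg (TensorProduct.comm R N (Localization.Away x)) hn
        simpa using this
      have : IsLocalizedModule (Submonoid.powers x) (TensorProduct.mk R (Localization.Away x) N 1) :=
        (isLocalizedModule_iff_isBaseChange (Submonoid.powers x) (Localization.Away x) _).2
          (TensorProduct.isBaseChange R N (Localization.Away x))
      obtain ⟨⟨_, k, rfl⟩, hk⟩ := (IsLocalizedModule.eq_zero_iff (Submonoid.powers x) (TensorProduct.mk R (Localization.Away x) N 1)).1 h1
      refine ⟨k, ?_⟩
      rw [hx', ← map_pow, algebraMap_smul]
      exact hk
    have hEx : ∀ e : N ⊗[R] (Cx x), e ∈ Gam (Ideal.span {x'}) (N ⊗[R] (Cx x)) := by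
      intro e
      induction e using TensorProduct.induction_on with
      | zero => exact zero_mem _
      | add _ _ h1 h2 => exact add_mem h1 h2
      | tmul n c =>
        obtain ⟨y, rfl⟩ := Submodule.mkQ_surjective _ c
        obtain ⟨k, r, hr⟩ := IsLocalization.Away.surj x y
        refine Gam_span_singleton (k := k) ?_
        rw [hx', ← map_pow, algebraMap_smul, ← TensorProduct.tmul_smul, ← map_smul]
        have : Submodule.mkQ (LinearMap.range (Algebra.linearMap R (Localization.Away x))) (x ^ k • y) = 0 := by
          rw [Submodule.mkQ_apply, Submodule.Quotient.mk_eq_zero]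
          refine ⟨r, ?_⟩
          rw [Algebra.linearMap_apply, ← hr, Algebra.smul_def, map_pow, mul_comm]
        rw [this, tmul_zero]
    have hEJ : ∀ e : N ⊗[R] (Cx x), e ∈ Gam J (N ⊗[R] (Cx x)) := by
      intro e
      induction e using TensorProduct.induction_on with
      | zero => exact zero_mem _
      | add _ _ h1 h2 => exact add_mem h1 h2
      | tmul n c =>
        obtain ⟨t, ht⟩ := hN n
        exact ⟨t, fun y hy => by rw [TensorProduct.smul_tmul', ht y hy, zero_tmul]⟩
    have hL : ∀ i, Subsingleton (H a i (N ⊗[R] Localization.Away x)) := by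
      intro i
      refine H_zero_of_inv hxa (TensorProduct.AlgebraTensorModule.map (LinearMap.id : N →ₗ[A] N)
        ((IsLocalization.Away.invSelf x : Localization.Away x) • (LinearMap.id : Localization.Away x →ₗ[R] Localization.Away x))) ?_ i
      ext n c
      simp only [hx', LinearMap.smul_apply, LinearMap.id_apply, algebraMap_smul,
        TensorProduct.AlgebraTensorModule.curry_apply, LinearMap.restrictScalars_self, TensorProduct.curry_apply,
        TensorProduct.AlgebraTensorModule.map_tmul, LinearMap.restrictScalars_apply]
      rw [← TensorProduct.tmul_smul]
      congr 1
      rw [Algebra.smul_def, smul_eq_mul, ← mul_assoc, IsLocalization.Away.mul_invSelf, one_mul]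
    have hrad : a ≤ ((J ⊔ Ideal.span {x'}) ⊔ Ideal.span {y | ∃ x ∈ l, algebraMap R A x = y}).radical := by
      refine hJ.trans (Ideal.radical_mono ?_)
      rw [sup_assoc, ← Ideal.span_union]
      refine sup_le_sup_left (Ideal.span_mono ?_) _
      rintro y ⟨z, hz, rfl⟩
      rcases List.mem_cons.1 hz with rfl | hz
      · left; rfl
      · right; exact ⟨z, hz, rfl⟩
    have ih' := ih (J ⊔ Ideal.span {x'}) (fun y hy => hl y (by simp [hy])) hrad
    obtain ⟨hK, -⟩ := ih' (LinearMap.ker f) (by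
      intro n
      refine Gam_sup ?_ ?_
      · obtain ⟨t, ht⟩ := hN n
        exact ⟨t, fun y hy => Subtype.ext (ht y hy)⟩
      · obtain ⟨k, hk⟩ := hkerx n n.2
        exact Gam_span_singleton (Subtype.ext hk))
    obtain ⟨hE, ⟨eE⟩⟩ := ih' (N ⊗[R] (Cx x)) (fun e => Gam_sup (hEJ e) (hEx e))
    have ex1 : Function.Exact (LinearMap.ker f).subtype f.rangeRestrict := by
      rw [← LinearMap.ker_rangeRestrict f]; exact LinearMap.exact_subtype_ker_map _
    have ex2 : Function.Exact (LinearMap.range f).subtype q := by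
      intro y
      rw [hfq y]; simp
    have hs1 : Function.Surjective f.rangeRestrict := LinearMap.surjective_rangeRestrict f
    have b1 : ∀ i, l.length ≤ i → Function.Bijective (Hmap a (i+1) f.rangeRestrict) := by
      intro i hi
      have h1 := hK (i+1) (by omega)
      have h2 := hK (i+1+1) (by omega)
      have e1 := exact_mid (a := a) (Submodule.injective_subtype _) ex1 hs1 (i+1)
      obtain ⟨δ, e2, e3⟩ := exists_delta (a := a) (Submodule.injective_subtype _) ex1 hs1 (i+1)
      constructor
      · rw [injective_iff_map_eq_zero]
        intro h hh
        obtain ⟨y, rfl⟩ := (e1 h).1 hh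
        rw [Subsingleton.elim y 0, map_zero]
      · intro h
        exact (e2 h).1 (Subsingleton.elim _ _)
    have b2 : ∀ i, ∃ δ : H a i (N ⊗[R] (Cx x)) →ₗ[A] H a (i+1) (LinearMap.range f), Function.Bijective δ := by
      intro i
      have h1 := hL i
      have h2 := hL (i+1)
      obtain ⟨δ, e2, e3⟩ := exists_delta (a := a) (Submodule.injective_subtype _) ex2 hq i
      refine ⟨δ, ?_, ?_⟩
      · rw [injective_iff_map_eq_zero]
        intro h hh
        obtain ⟨y, rfl⟩ := (e2 h).1 hh
        rw [Subsingleton.elim y 0, map_zero]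
      · intro h
        exact (e3 h).1 (Subsingleton.elim _ _)
    have e0 : ∀ i, l.length ≤ i → Nonempty (H a (i+1) N ≃ₗ[A] H a i (N ⊗[R] (Cx x))) := by
      intro i hi
      obtain ⟨δ, hδ⟩ := b2 i
      exact ⟨LinearEquiv.ofBijective _ (b1 i hi) ≪≫ₗ (LinearEquiv.ofBijective δ hδ).symm⟩
    constructor
    · intro i hi
      rw [List.length_cons] at hi
      obtain ⟨i, rfl⟩ := Nat.exists_eq_succ_of_ne_zero (show i ≠ 0 by omega)
      obtain ⟨e⟩ := e0 i (by omega)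
      have := hE i (by omega)
      exact e.toEquiv.subsingleton
    · obtain ⟨e⟩ := e0 l.length le_rfl
      exact ⟨e ≪≫ₗ eE ≪≫ₗ TensorProduct.AlgebraTensorModule.assoc R R A N (Cx x) (Cmod l)⟩
end
end LC

namespace LC

section
variable {R : Type u} [CommRing R]

lemma wb_succ_le {x : WithBot ℕ∞} {d : ℕ} (h : x + 1 ≤ ((d + 1 : ℕ) : WithBot ℕ∞)) : x ≤ (d : WithBot ℕ∞) := by
  induction x using WithBot.recBotCoe with
  | bot => exact bot_le
  | coe x =>
    induction x using ENat.recTopCoe with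
    | top => exact absurd h (by rw [not_le]; exact WithBot.coe_lt_coe.2 (ENat.natCast_lt_top _))
    | coe x => norm_cast at h ⊢; omega

lemma dim_succ_le {p q : Ideal R} [p.IsPrime] (hpq : p < q) :
    ringKrullDim (R ⧸ q) + 1 ≤ ringKrullDim (R ⧸ p) := by
  obtain ⟨x, hxq, hxp⟩ := SetLike.exists_of_lt hpq
  refine ringKrullDim_succ_le_of_surjective (Ideal.Quotient.factor hpq.le)
    (Ideal.Quotient.factor_surjective _) (r := Ideal.Quotient.mk p x) ?_ ?_
  · rw [mem_nonZeroDivisors_iff_ne_zero]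
    exact fun h => hxp (Ideal.Quotient.eq_zero_iff_mem.1 h)
  · rw [Ideal.Quotient.factor_mk]; exact Ideal.Quotient.eq_zero_iff_mem.2 hxq

lemma dim_anti {p q : Ideal R} (hpq : p ≤ q) :
    ringKrullDim (R ⧸ q) ≤ ringKrullDim (R ⧸ p) :=
  ringKrullDim_le_of_surjective (Ideal.Quotient.factor hpq) (Ideal.Quotient.factor_surjective _)

lemma exists_list_aux [IsNoetherianRing R] [IsLocalRing R] (a : Ideal R) (ha : a ≠ ⊤) (d : ℕ) : ∀ (I : Ideal R),
    (∀ q : Ideal R, q.IsPrime → I ≤ q → ¬ a ≤ q → ringKrullDim (R ⧸ q) ≤ d) →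
    ∃ l : List R, l.length = d ∧ (∀ x ∈ l, x ∈ a) ∧ a ≤ (I ⊔ Ideal.span {x | x ∈ l}).radical := by
  induction d with
  | zero =>
    intro I h
    refine ⟨[], rfl, by simp, ?_⟩
    simp only [List.not_mem_nil, Set.ofPred_false, Ideal.span_empty, bot_le, sup_of_le_left]
    rw [Ideal.radical_eq_sInf]
    refine le_sInf fun q hq => ?_
    by_contra hc
    have := hq.2
    have h1 := h q hq.2 hq.1 hc
    have hne : q < IsLocalRing.maximalIdeal R := lt_of_le_of_ne (IsLocalRing.le_maximalIdeal hq.2.ne_top)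
      (by rintro rfl; exact hc (IsLocalRing.le_maximalIdeal ha))
    have h2 := dim_succ_le hne
    have h3 : (0 : WithBot ℕ∞) ≤ ringKrullDim (R ⧸ IsLocalRing.maximalIdeal R) := ringKrullDim_nonneg_of_nontrivial
    have h4 : (0 : WithBot ℕ∞) + 1 ≤ 0 := (add_le_add_left h3 1).trans (h2.trans h1)
    exact absurd h4 (by norm_num)
  | succ d ih =>
    intro I h
    have hfin : {p ∈ I.minimalPrimes | ¬ a ≤ p}.Finite :=
      (Ideal.finite_minimalPrimes_of_isNoetherianRing R I).subset (fun _ h => h.1)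
    obtain ⟨x, hxa, hx⟩ : ∃ x ∈ a, ∀ p ∈ I.minimalPrimes, ¬ a ≤ p → x ∉ p := by
      by_contra! hc
      have := (Ideal.subset_union_prime_finite hfin (f := id) 0 0 (fun p hp _ _ => hp.1.1.1) (I := a)).1 (by
        intro x hx
        obtain ⟨p, hp, hap, hxp⟩ := hc x hx
        simp only [Set.mem_iUnion]
        exact ⟨p, ⟨hp, hap⟩, hxp⟩)
      obtain ⟨p, hp, hap⟩ := this
      exact hp.2 hap
    obtain ⟨l, hl, hla, hr⟩ := ih (I ⊔ Ideal.span {x}) (by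
      intro q hq hIq haq
      obtain ⟨p, hp, hpq⟩ := Ideal.exists_minimalPrimes_le (le_sup_left.trans hIq)
      have hap : ¬ a ≤ p := fun h => haq (h.trans hpq)
      have := hp.1.1
      have hlt : p < q := lt_of_le_of_ne hpq (by
        rintro rfl
        exact hx p hp hap (hIq (le_sup_right (a := I) (Ideal.mem_span_singleton_self x))))
      exact wb_succ_le ((dim_succ_le hlt).trans (h p hp.1.1 hp.1.2 hap)))
    refine ⟨x :: l, by simp [hl], ?_, ?_⟩
    · intro y hy
      rcases List.mem_cons.1 hy with rfl | hy
      exacts [hxa, hla y hy]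
    · refine hr.trans (Ideal.radical_mono ?_)
      refine sup_le (sup_le le_sup_left (le_sup_of_le_right (Ideal.span_mono ?_))) (le_sup_of_le_right (Ideal.span_mono ?_))
      · simp
      · intro y hy; exact List.mem_cons_of_mem _ hy

lemma exists_list [IsNoetherianRing R] [IsLocalRing R] (a : Ideal R) (ha : a ≠ ⊤) (d : ℕ) (I : Ideal R)
    (h : ringKrullDim (R ⧸ I) ≤ d) :
    ∃ l : List R, l.length = d ∧ (∀ x ∈ l, x ∈ a) ∧ a ≤ (I ⊔ Ideal.span {x | x ∈ l}).radical :=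
  exists_list_aux a ha d I fun _ _ hq _ => (dim_anti hq).trans h

lemma dim_le_of_list [IsNoetherianRing R] [IsLocalRing R] (l : List R) (I : Ideal R)
    (hl : ∀ x ∈ l, x ∈ IsLocalRing.maximalIdeal R)
    (h : IsLocalRing.maximalIdeal R ≤ (I ⊔ Ideal.span {x | x ∈ l}).radical) :
    ringKrullDim (R ⧸ I) ≤ (l.length : WithBot ℕ∞) := by
  by_cases hI : I = ⊤
  · have : Subsingleton (R ⧸ I) := Ideal.Quotient.subsingleton_iff.2 hI
    rw [ringKrullDim_eq_bot_of_subsingleton]; exact bot_le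
  have : Nontrivial (R ⧸ I) := Ideal.Quotient.nontrivial_iff.2 hI
  have : IsLocalRing (R ⧸ I) := IsLocalRing.of_surjective' _ Ideal.Quotient.mk_surjective
  classical
  rw [← IsLocalRing.maximalIdeal_height_eq_ringKrullDim]
  have hloc : IsLocalHom (Ideal.Quotient.mk I) := IsLocalHom.of_surjective _ Ideal.Quotient.mk_surjective
  let S : Finset (R ⧸ I) := (l.map (Ideal.Quotient.mk I)).toFinset
  have hcard : S.card ≤ l.length := by
    refine (List.toFinset_card_le _).trans ?_
    simp
  have hmin : IsLocalRing.maximalIdeal (R ⧸ I) ∈ (Ideal.span (S : Set (R ⧸ I))).minimalPrimes := by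
    refine ⟨⟨inferInstance, ?_⟩, ?_⟩
    · rw [Ideal.span_le]
      intro y hy
      simp only [S, List.coe_toFinset, List.mem_map, Set.mem_ofPred_eq] at hy
      obtain ⟨x, hx, rfl⟩ := hy
      exact (IsLocalRing.mem_maximalIdeal _).2 fun hu => (IsLocalRing.mem_maximalIdeal _).1 (hl x hx) (hloc.map_nonunit x hu)
    · rintro q ⟨hq, hSq⟩ -
      intro y hy
      obtain ⟨x, rfl⟩ := Ideal.Quotient.mk_surjective y
      have hx : x ∈ IsLocalRing.maximalIdeal R := (IsLocalRing.mem_maximalIdeal _).2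
        fun hu => (IsLocalRing.mem_maximalIdeal _).1 hy (hu.map _)
      obtain ⟨n, hn⟩ := h hx
      have hqp : (q.comap (Ideal.Quotient.mk I)).IsPrime := Ideal.IsPrime.comap _
      have hle : I ⊔ Ideal.span {x | x ∈ l} ≤ q.comap (Ideal.Quotient.mk I) := by
        refine sup_le ?_ ?_
        · intro z hz
          rw [Ideal.mem_comap, Ideal.Quotient.eq_zero_iff_mem.2 hz]; exact zero_mem _
        · rw [Ideal.span_le]
          intro z hz
          refine hSq (Ideal.subset_span ?_)
          simp only [S, List.coe_toFinset, List.mem_map, Set.mem_ofPred_eq]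
          exact ⟨z, hz, rfl⟩
      exact hqp.mem_of_pow_mem _ (hle hn)
  have h1 := Ideal.height_le_spanRank_toENat_of_mem_minimalPrimes _ _ hmin
  have h2 : (Submodule.spanRank (Ideal.span (S : Set (R ⧸ I)))).toENat ≤ (l.length : ℕ∞) := by
    have := Submodule.spanRank_span_le_card (R := R ⧸ I) (S : Set (R ⧸ I))
    refine (Cardinal.toENat.monotone' this).trans ?_
    simpa using hcard
  exact_mod_cast h1.trans h2

end
end LC

namespace LC

section
variable {R : Type u} [CommRing R] {a : Ideal R} {i d : ℕ}
variable {N : Type u} [AddCommGroup N] [Module R N] {N' : Type u} [AddCommGroup N'] [Module R N']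
  {N'' : Type u} [AddCommGroup N''] [Module R N'']
open TensorProduct

lemma H_top (ha : a = ⊤) : Subsingleton (H a i N) := by
  refine subsingleton_of_forall_eq 0 fun h => ?_
  obtain ⟨t, ht⟩ := torsion h
  have := ht 1 (by rw [ha]; simp [Ideal.top_pow])
  rwa [one_smul] at this

lemma Gam_of_killed {I : Ideal R} (hN : ∀ r ∈ I, ∀ n : N, r • n = 0) (n : N) : n ∈ Gam I N :=
  ⟨1, fun x hx => hN x (by simpa using hx) n⟩

lemma comp' [IsNoetherianRing R] (l : List R) (I : Ideal R) (hla : ∀ x ∈ l, x ∈ a)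
    (hr : a ≤ (I ⊔ Ideal.span {x | x ∈ l}).radical) (hN : ∀ r ∈ I, ∀ n : N, r • n = 0) :
    (∀ i, l.length < i → Subsingleton (H a i N)) ∧
        Nonempty (H a l.length N ≃ₗ[R] N ⊗[R] (Cmod l : Type u)) := by
  refine comp (R := R) a l I hla ?_ N (Gam_of_killed hN)
  simpa using hr

lemma dim_le_of_killed [Module.Finite R N] {I : Ideal R} (hN : ∀ r ∈ I, ∀ n : N, r • n = 0) :
    Module.supportDim R N ≤ ringKrullDim (R ⧸ I) := by
  rw [Module.supportDim_eq_ringKrullDim_quotient_annihilator]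
  exact dim_anti fun r hr => Module.mem_annihilator.2 (hN r hr)

lemma H_vanish [IsNoetherianRing R] [IsLocalRing R] [Module.Finite R N]
    (h : Module.supportDim R N ≤ d) (hi : d < i) : Subsingleton (H a i N) := by
  by_cases ha : a = ⊤
  · exact H_top ha
  rw [Module.supportDim_eq_ringKrullDim_quotient_annihilator] at h
  obtain ⟨l, hl, hla, hr⟩ := exists_list a ha d _ h
  exact (comp' l _ hla hr (fun r hr n => Module.mem_annihilator.1 hr n)).1 i (hl ▸ hi)

lemma H_surj [IsNoetherianRing R] [IsLocalRing R] [Module.Finite R N] (h : Module.supportDim R N ≤ d)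
    {g : N →ₗ[R] N'} (hg : Function.Surjective g) : Function.Surjective (Hmap a d g) :=
  H_surj_of_vanish hg d (H_vanish (d := d)
    ((Module.supportDim_le_of_injective _ (Submodule.injective_subtype _)).trans h) (by omega))

lemma H_quot_zero [IsNoetherianRing R] [IsLocalRing R] [Module.Finite R N] (h : Module.supportDim R N ≤ d)
    {g : N →ₗ[R] N'} (hg : Function.Surjective g) (h0 : Subsingleton (H a d N)) : Subsingleton (H a d N') :=
  (H_surj h hg).subsingleton

lemma H_ext_zero {f : N' →ₗ[R] N} {g : N →ₗ[R] N''} (hf : Function.Injective f) (hfg : Function.Exact f g)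
    (hg : Function.Surjective g) (i : ℕ)
    (h1 : Subsingleton (H a i N')) (h2 : Subsingleton (H a i N'')) : Subsingleton (H a i N) := by
  refine subsingleton_of_forall_eq 0 fun h => ?_
  obtain ⟨y, rfl⟩ := (exact_mid (a := a) hf hfg hg i h).1 (Subsingleton.elim _ _)
  rw [Subsingleton.elim y 0, map_zero]

/-- If an ideal kills top cohomology, it is enough to look at quotients killed by the ideal. -/
lemma H_zero_of_quot [IsNoetherianRing R] [IsLocalRing R] (a : Ideal R) (d : ℕ) (I : Ideal R) :
    ∀ (N : Type u) [AddCommGroup N] [Module R N] [Module.Finite R N] (_ : Module.supportDim R N ≤ d)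
      (_ : ∀ r ∈ I, ∀ h : H a d N, r • h = 0)
      (_ : ∀ (N' : Type u) [AddCommGroup N'] [Module R N'] (g : N →ₗ[R] N'), Function.Surjective g →
        (∀ r ∈ I, ∀ n : N', r • n = 0) → Subsingleton (H a d N')), Subsingleton (H a d N) := by
  have hI : I.FG := IsNoetherian.noetherian I
  induction I, hI using Submodule.fg_induction with
  | singleton x =>
    intro N _ _ _ hd hk hq
    let T : Submodule R N := LinearMap.range (x • LinearMap.id : N →ₗ[R] N)
    have h1 := hq (N ⧸ T) T.mkQ (Submodule.mkQ_surjective _) (by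
      intro r hr n
      obtain ⟨n, rfl⟩ := Submodule.mkQ_surjective _ n
      obtain ⟨c, rfl⟩ := Submodule.mem_span_singleton.1 hr
      rw [← map_smul, Submodule.mkQ_apply, Submodule.Quotient.mk_eq_zero]
      refine ⟨c • n, ?_⟩
      simp only [LinearMap.smul_apply, LinearMap.id_apply, smul_eq_mul, mul_smul]
      rw [smul_comm])
    have hsurj := H_surj (a := a) hd (LinearMap.surjective_rangeRestrict (x • LinearMap.id : N →ₗ[R] N))
    have hex : Function.Exact T.subtype T.mkQ := LinearMap.exact_subtype_mkQ T
    refine subsingleton_of_forall_eq 0 fun h => ?_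
    obtain ⟨y, rfl⟩ := (exact_mid (a := a) (Submodule.injective_subtype _) hex (Submodule.mkQ_surjective _) d h).1
      (Subsingleton.elim _ _)
    obtain ⟨z, rfl⟩ := hsurj y
    rw [← LinearMap.comp_apply, ← Hmap_comp]
    have : T.subtype ∘ₗ (x • LinearMap.id : N →ₗ[R] N).rangeRestrict = x • LinearMap.id := by ext; rfl
    rw [this, Hmap_smul_id]
    exact hk x (Submodule.mem_span_singleton_self x) z
  | sup I₁ I₂ h₁ h₂ ih1 ih2 =>
    intro N _ _ _ hd hk hq
    refine ih1 N hd (fun r hr => hk r (le_sup_left (a := I₁) hr)) ?_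
    intro N' _ _ g hg hN'
    have : Module.Finite R N' := Module.Finite.of_surjective g hg
    refine ih2 N' ((Module.supportDim_le_of_surjective g hg).trans hd) ?_ ?_
    · intro r hr h
      obtain ⟨y, rfl⟩ := H_surj (a := a) hd hg h
      rw [← map_smul, hk r (le_sup_right (a := I₁) hr), map_zero]
    · intro N'' _ _ g' hg' hN''
      refine hq N'' (g' ∘ₗ g) (hg'.comp hg) ?_
      intro r hr n
      obtain ⟨y, hy, z, hz, rfl⟩ := Submodule.mem_sup.1 hr
      obtain ⟨m, rfl⟩ := hg' n
      rw [add_smul, hN'' z hz, ← map_smul, hN' y hy, map_zero, add_zero]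

lemma dim_lt_of_killed [IsNoetherianRing R] [IsLocalRing R] (P : Ideal R) [P.IsPrime] {b : R} (hb : b ∉ P)
    (h : ringKrullDim (R ⧸ P) ≤ d) {N : Type u} [AddCommGroup N] [Module R N] [Module.Finite R N]
    (hP : ∀ r ∈ P, ∀ n : N, r • n = 0) (hb' : ∀ n : N, b • n = 0) : Subsingleton (H a d N) := by
  have hlt : P < P ⊔ Ideal.span {b} := by
    refine lt_of_le_of_ne le_sup_left fun hc => hb ?_
    rw [hc]; exact le_sup_right (a := P) (Ideal.mem_span_singleton_self b)
  have h1 : Module.supportDim R N ≤ ringKrullDim (R ⧸ (P ⊔ Ideal.span {b})) := dim_le_of_killed (by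
    intro r hr n
    obtain ⟨y, hy, z, hz, rfl⟩ := Submodule.mem_sup.1 hr
    obtain ⟨c, rfl⟩ := Ideal.mem_span_singleton'.1 hz
    rw [add_smul, hP y hy, mul_smul, hb', smul_zero, add_zero])
  have h2 := dim_succ_le hlt
  cases d with
  | zero =>
    have h3 : Module.supportDim R N = ⊥ := by
      have h4 : Module.supportDim R N + 1 ≤ (0 : ℕ) := (add_le_add_left h1 1).trans (h2.trans h)
      revert h4
      generalize Module.supportDim R N = y
      intro h4
      induction y using WithBot.recBotCoe with
      | bot => rfl
      | coe y =>
        exfalso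
        have : y + 1 ≤ 0 := by exact_mod_cast h4
        simp at this
    have := (Module.supportDim_eq_bot_iff_subsingleton R N).1 h3
    exact H_zero
  | succ d =>
    exact H_vanish (d := d) (h1.trans (wb_succ_le (h2.trans h))) (by omega)

/-- nonvanishing -/
lemma NV [IsNoetherianRing R] [IsLocalRing R] [Module.Finite R N] (hd : Module.supportDim R N ≤ d)
    (P : Ideal R) [hP : P.IsPrime] (hs : Module.annihilator R N ≤ P) (h : Subsingleton (H a d N)) :
    Subsingleton (H a d (R ⧸ P)) := by
  have hdP : ringKrullDim (R ⧸ P) ≤ d := by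
    rw [Module.supportDim_eq_ringKrullDim_quotient_annihilator] at hd
    exact (dim_anti hs).trans hd
  -- `T` maximal with `Ann (N/T) ≤ P`
  obtain ⟨T, hT, hmax⟩ : ∃ T : Submodule R N, Module.annihilator R (N ⧸ T) ≤ P ∧
      ∀ T', T < T' → ¬ Module.annihilator R (N ⧸ T') ≤ P := by
    have hne : {T : Submodule R N | Module.annihilator R (N ⧸ T) ≤ P}.Nonempty := by
      refine ⟨⊥, ?_⟩
      have := (Submodule.quotEquivOfEqBot (⊥ : Submodule R N) rfl).annihilator_eq
      simpa [this] using hs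
    obtain ⟨T, hT, hm⟩ := wellFounded_gt.has_min _ hne
    exact ⟨T, hT, fun T' hlt hT' => hm T' hT' hlt⟩
  set Y := N ⧸ T with hY
  have hYd : Module.supportDim R Y ≤ d := (Module.supportDim_le_of_surjective _ (Submodule.mkQ_surjective T)).trans hd
  have hY0 : Subsingleton (H a d Y) := H_quot_zero hd (Submodule.mkQ_surjective T) h
  have key : ∀ W : Submodule R Y, W ≠ ⊥ → ∃ b, b ∉ P ∧ ∀ y : Y, b • y ∈ W := by
    intro W hW
    have hlt : T < W.comap T.mkQ := by
      refine lt_of_le_of_ne ?_ ?_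
      · intro x hx
        rw [Submodule.mem_comap, Submodule.mkQ_apply, (Submodule.Quotient.mk_eq_zero T).2 hx]
        exact zero_mem _
      · intro hc
        apply hW
        rw [eq_bot_iff]
        intro y hy
        obtain ⟨n, rfl⟩ := Submodule.mkQ_surjective _ y
        have : n ∈ T := by rw [hc]; exact hy
        exact (Submodule.Quotient.mk_eq_zero T).2 this
    obtain ⟨b, hb, hbP⟩ := SetLike.not_le_iff_exists.1 (hmax _ hlt)
    refine ⟨b, hbP, fun y => ?_⟩
    obtain ⟨n, rfl⟩ := Submodule.mkQ_surjective _ y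
    have h1 := Module.mem_annihilator.1 hb (Submodule.Quotient.mk n)
    rw [← Submodule.Quotient.mk_smul, Submodule.Quotient.mk_eq_zero, Submodule.mem_comap, map_smul] at h1
    exact h1
  have hPY : ∀ r ∈ P, ∀ y : Y, r • y = 0 := by
    by_contra hc
    have hne : P • (⊤ : Submodule R Y) ≠ ⊥ := by
      intro h0
      apply hc
      intro r hr y
      have : r • y ∈ P • (⊤ : Submodule R Y) := Submodule.smul_mem_smul hr trivial
      rw [h0] at this
      exact this
    obtain ⟨b, hbP, hb⟩ := key _ hne
    obtain ⟨p, hp, -, hcoeff, haev⟩ := LinearMap.exists_monic_and_natDegree_eq_and_coeff_mem_pow_and_aeval_eq_zero R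
      (b • LinearMap.id : Y →ₗ[R] Y) P (by rintro _ ⟨y, rfl⟩; exact hb y)
    have h1 : p.eval b ∈ P := by
      refine hT (Module.mem_annihilator.2 fun y => ?_)
      have e1 : (b • LinearMap.id : Y →ₗ[R] Y) = algebraMap R (Module.End R Y) b := rfl
      rw [e1, Polynomial.aeval_algebraMap_apply] at haev
      exact LinearMap.congr_fun haev y
    have h2 : p.map (Ideal.Quotient.mk P) = Polynomial.X ^ p.natDegree := by
      ext k
      rw [Polynomial.coeff_map, Polynomial.coeff_X_pow]
      split_ifs with hk
      · rw [hk, hp.coeff_natDegree, map_one]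
      · rcases lt_or_gt_of_ne hk with hk | hk
        · rw [Ideal.Quotient.eq_zero_iff_mem]
          exact Ideal.pow_le_self (by omega) (hcoeff k)
        · rw [Polynomial.coeff_eq_zero_of_natDegree_lt hk, map_zero]
    have h3 : (p.map (Ideal.Quotient.mk P)).eval (Ideal.Quotient.mk P b) = 0 := by
      rw [Polynomial.eval_map_apply, Ideal.Quotient.eq_zero_iff_mem]; exact h1
    rw [h2, Polynomial.eval_pow, Polynomial.eval_X, ← map_pow, Ideal.Quotient.eq_zero_iff_mem] at h3
    exact hbP (hP.mem_of_pow_mem _ h3)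
  have hann : ∀ s, (∀ y : Y, s • y = 0) → s ∈ P := fun s hs => hT (Module.mem_annihilator.2 hs)
  obtain ⟨y, hy⟩ : ∃ y : Y, y ≠ 0 := by
    by_contra! hc
    exact hP.ne_top ((Ideal.eq_top_iff_one _).2 (hann 1 fun y => by simp [hc]))
  obtain ⟨b, hbP, hb⟩ := key (Submodule.span R {y}) (by simpa using hy)
  let g : (R ⧸ P) →ₗ[R] Y := Submodule.liftQ P (LinearMap.toSpanSingleton R Y y) (fun r hr => hPY r hr y)
  have hg : ∀ r : R, g (Submodule.Quotient.mk r) = r • y := fun r => rfl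
  have hginj : Function.Injective g := by
    rw [injective_iff_map_eq_zero]
    intro z hz
    obtain ⟨s, rfl⟩ := Submodule.Quotient.mk_surjective _ z
    rw [hg] at hz
    rw [Submodule.Quotient.mk_eq_zero]
    refine (hP.mem_or_mem (hann (b * s) fun w => ?_)).resolve_left hbP
    obtain ⟨c, hc⟩ := Submodule.mem_span_singleton.1 (hb w)
    rw [mul_comm, mul_smul, ← hc, smul_comm, hz, smul_zero]
  have hrange : ∀ w, (b • LinearMap.id : Y →ₗ[R] Y) w ∈ LinearMap.range g := by
    intro w
    obtain ⟨c, hc⟩ := Submodule.mem_span_singleton.1 (hb w)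
    exact ⟨Submodule.Quotient.mk c, hc⟩
  let φ : Y →ₗ[R] R ⧸ P := (LinearEquiv.ofInjective g hginj).symm.toLinearMap ∘ₗ
    (LinearMap.codRestrict _ (b • LinearMap.id : Y →ₗ[R] Y) hrange)
  have hφ : ∀ w, g (φ w) = b • w := by
    intro w
    have := LinearEquiv.apply_symm_apply (LinearEquiv.ofInjective g hginj) (LinearMap.codRestrict _ (b • LinearMap.id : Y →ₗ[R] Y) hrange w)
    exact congrArg Subtype.val this
  have h1 : Subsingleton (H a d (LinearMap.range φ)) := H_quot_zero hYd φ.surjective_rangeRestrict hY0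
  have h2 : Subsingleton (H a d ((R ⧸ P) ⧸ LinearMap.range φ)) := by
    refine dim_lt_of_killed P hbP hdP ?_ ?_
    · intro r hr n
      obtain ⟨z, rfl⟩ := Submodule.mkQ_surjective _ n
      obtain ⟨s, rfl⟩ := Submodule.Quotient.mk_surjective _ z
      rw [← map_smul, ← Submodule.Quotient.mk_smul, (Submodule.Quotient.mk_eq_zero P).2 (by rw [smul_eq_mul]; exact Ideal.mul_mem_right _ _ hr), map_zero]
    · intro n
      obtain ⟨z, rfl⟩ := Submodule.mkQ_surjective _ n
      obtain ⟨s, rfl⟩ := Submodule.Quotient.mk_surjective _ z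
      rw [← map_smul, Submodule.mkQ_apply, Submodule.Quotient.mk_eq_zero]
      refine ⟨s • y, hginj ?_⟩
      rw [hφ, map_smul, hg]
  exact H_ext_zero (Submodule.injective_subtype _) (LinearMap.exact_subtype_mkQ _) (Submodule.mkQ_surjective _) d h1 h2

/-- converse -/
lemma NVconv [IsNoetherianRing R] [IsLocalRing R] (N : Type u) [AddCommGroup N] [Module R N] [hfin : Module.Finite R N] :
    ¬ Subsingleton (H a d N) → ∃ P : Ideal R, P.IsPrime ∧ Module.annihilator R N ≤ P ∧ ¬ Subsingleton (H a d (R ⧸ P)) := by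
  induction hfin using IsNoetherianRing.induction_on_isQuotientEquivQuotientPrime R with
  | subsingleton N => intro h; exact absurd H_zero h
  | quotient N p e =>
    intro h
    refine ⟨p.1, p.2, ?_, fun hc => h (Hequiv a d e).toEquiv.subsingleton⟩
    rw [e.annihilator_eq, Ideal.annihilator_quotient]
  | exact N₁ N₂ N₃ f g hf hg hfg h1 h3 =>
    intro h
    by_cases h1' : Subsingleton (H a d N₁)
    · by_cases h3' : Subsingleton (H a d N₃)
      · exact absurd (H_ext_zero hf hfg hg d h1' h3') h
      · obtain ⟨P, hP, hle, hPn⟩ := h3 h3'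
        exact ⟨P, hP, (LinearMap.annihilator_le_of_surjective g hg).trans hle, hPn⟩
    · obtain ⟨P, hP, hle, hPn⟩ := h1 h1'
      exact ⟨P, hP, (LinearMap.annihilator_le_of_injective f hf).trans hle, hPn⟩
end
end LC

namespace LC

section
variable {R : Type u} [CommRing R]

/-- essential -/
def Ess {I : Type u} [AddCommGroup I] [Module R I] (K : Submodule R I) (L : Submodule R I) : Prop :=
  ∀ x ∈ L, x ≠ 0 → ∃ r : R, r • x ∈ K ∧ r • x ≠ 0

lemma exists_hull [IsLocalRing R] : ∃ (E : Type u) (_ : AddCommGroup E) (_ : Module R E), Module.Injective R E ∧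
    (∃ e : E, e ≠ 0 ∧ (∀ r ∈ IsLocalRing.maximalIdeal R, r • e = 0) ∧
      ∀ e' : E, (∀ r ∈ IsLocalRing.maximalIdeal R, r • e' = 0) → ∃ c : R, e' = c • e) := by
  set m := IsLocalRing.maximalIdeal R
  obtain ⟨I, _, _, hI, f, hf⟩ := exists_injective_embedding (R := R) (R ⧸ m)
  let K := LinearMap.range f
  obtain ⟨E, -, hE⟩ := zorn_le_nonempty₀ {L : Submodule R I | K ≤ L ∧ Ess K L} (by
    intro c hc hch L hL
    refine ⟨sSup c, ⟨(hc hL).1.trans (le_sSup hL), ?_⟩, fun z hz => le_sSup hz⟩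
    intro x hx hx0
    rw [Submodule.mem_sSup_of_directed ⟨L, hL⟩ hch.directedOn] at hx
    obtain ⟨y, hy, hxy⟩ := hx
    exact (hc hy).2 x hxy hx0) K ⟨le_rfl, fun x hx h0 => ⟨1, by simpa using hx, by simpa using h0⟩⟩
  obtain ⟨⟨hKE, hess⟩, hmax⟩ := hE
  obtain ⟨C, -, hC⟩ := zorn_le_nonempty₀ {C : Submodule R I | Disjoint C E} (by
    intro c hc hch L hL
    refine ⟨sSup c, ?_, fun z hz => le_sSup hz⟩
    show Disjoint _ _
    rw [Submodule.disjoint_def]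
    intro x hx hxE
    rw [Submodule.mem_sSup_of_directed ⟨L, hL⟩ hch.directedOn] at hx
    obtain ⟨y, hy, hxy⟩ := hx
    exact Submodule.disjoint_def.1 (hc hy) x hxy hxE) ⊥ disjoint_bot_left
  obtain ⟨hCE, hCmax⟩ := hC
  have hCE' := Submodule.disjoint_def.1 hCE
  -- essential in I/C
  have hess2 : ∀ x : I, x ∉ C → ∃ r : R, ∃ e ∈ E, e ≠ 0 ∧ r • x - e ∈ C := by
    intro x hx
    by_contra! hc
    have : C ⊔ Submodule.span R {x} ≤ C := hCmax (by
      show Disjoint _ _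
      rw [Submodule.disjoint_def]
      intro y hy hyE
      by_contra hy0
      obtain ⟨z, hz, w, hw, rfl⟩ := Submodule.mem_sup.1 hy
      obtain ⟨r, rfl⟩ := Submodule.mem_span_singleton.1 hw
      refine hc r _ hyE hy0 ?_
      have : r • x - (z + r • x) = - z := by abel
      rw [this]; exact neg_mem hz) le_sup_left
    exact hx (this (le_sup_right (a := C) (Submodule.mem_span_singleton_self x)))
  let j : E →ₗ[R] (I ⧸ C) := C.mkQ ∘ₗ E.subtype
  obtain ⟨φ, hφ⟩ := extend_of_ker_le j E.subtype (by
    intro e he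
    have : (e : I) ∈ C := (Submodule.Quotient.mk_eq_zero C).1 he
    have := hCE' e this e.2
    exact this)
  have hφE : ∀ e ∈ E, φ (C.mkQ e) = e := fun e he => LinearMap.congr_fun hφ ⟨e, he⟩
  have hφC : ∀ z ∈ C, φ (C.mkQ z) = 0 := fun z hz => by
    rw [Submodule.mkQ_apply, (Submodule.Quotient.mk_eq_zero C).2 hz, map_zero]
  have hle : LinearMap.range φ ≤ E := by
    refine hmax ⟨fun k hk => ⟨C.mkQ k, hφE k (hKE hk)⟩, ?_⟩ (fun k hk => ⟨C.mkQ k, hφE k hk⟩)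
    rintro _ ⟨y, rfl⟩ h0
    obtain ⟨x, rfl⟩ := Submodule.mkQ_surjective _ y
    have hxC : x ∉ C := fun h => h0 (hφC x h)
    obtain ⟨r, e, he, he0, hre⟩ := hess2 x hxC
    have h1 : r • φ (C.mkQ x) = e := by
      have := hφC _ hre
      rw [map_sub, map_sub, hφE e he, sub_eq_zero, map_smul, map_smul] at this
      exact this
    obtain ⟨s, hs1, hs2⟩ := hess e he he0
    exact ⟨s * r, by rw [mul_smul, h1]; exact hs1, by rw [mul_smul, h1]; exact hs2⟩
  let ρ : I →ₗ[R] E := LinearMap.codRestrict E (φ ∘ₗ C.mkQ) (fun x => hle ⟨_, rfl⟩)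
  refine ⟨E, inferInstance, inferInstance, ?_, ?_⟩
  · refine ⟨fun X Y _ _ _ _ g hg h => ?_⟩
    obtain ⟨k, hk⟩ := hI.out g hg (E.subtype ∘ₗ h)
    exact ⟨ρ ∘ₗ k, fun x => Subtype.ext (by
      have : ((ρ ∘ₗ k) (g x) : I) = φ (C.mkQ (k (g x))) := rfl
      rw [this, hk]
      exact hφE _ (h x).2)⟩
  · have h1E : f (Ideal.Quotient.mk m 1) ∈ E := hKE ⟨_, rfl⟩
    have hsm : ∀ c : R, f (Ideal.Quotient.mk m c) = c • f (Ideal.Quotient.mk m 1) := fun c => by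
      rw [← map_smul]; congr 1
      rw [← mul_one c, map_mul]; simp [Algebra.smul_def]
    refine ⟨⟨f (Ideal.Quotient.mk m 1), h1E⟩, ?_, ?_, ?_⟩
    · intro h
      have h2 : f (Ideal.Quotient.mk m 1) = 0 := congrArg Subtype.val h
      rw [map_eq_zero_iff f hf, Ideal.Quotient.eq_zero_iff_mem] at h2
      exact (Ideal.ne_top_iff_one _).1 (IsLocalRing.maximalIdeal.isMaximal R).ne_top h2
    · intro r hr
      refine Subtype.ext ?_
      show r • f (Ideal.Quotient.mk m 1) = 0
      rw [← hsm, Ideal.Quotient.eq_zero_iff_mem.2 hr, map_zero]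
    · intro e' he'
      by_cases h0 : e' = 0
      · exact ⟨0, by rw [h0, zero_smul]⟩
      obtain ⟨r, hr1, hr2⟩ := hess e' e'.2 (fun h => h0 (Subtype.ext h))
      have hru : IsUnit r := by
        by_contra hnu
        exact hr2 (congrArg Subtype.val (he' r ((IsLocalRing.mem_maximalIdeal r).2 hnu)))
      obtain ⟨u, rfl⟩ := hru
      obtain ⟨y, hy⟩ := hr1
      obtain ⟨c, rfl⟩ := Ideal.Quotient.mk_surjective y
      refine ⟨(↑u⁻¹ : R) * c, Subtype.ext ?_⟩
      show (e' : I) = ((↑u⁻¹ : R) * c) • f (Ideal.Quotient.mk m 1)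
      rw [mul_smul, ← hsm, hy, ← mul_smul, Units.inv_mul, one_smul]
end
end LC

namespace LC

section
variable {R : Type u} [CommRing R]

lemma mem_smul_top_pi {g : ℕ} (J : Ideal R) (v : Fin g → R) :
    v ∈ (J • ⊤ : Submodule R (Fin g → R)) ↔ ∀ i, v i ∈ J := by
  constructor
  · intro h i
    refine Submodule.smul_induction_on h ?_ ?_
    · intro r hr n _
      simpa using Ideal.mul_mem_right _ _ hr
    · intro x y hx hy
      exact add_mem hx hy
  · intro h
    have : v = ∑ i, v i • (Pi.single i (1 : R) : Fin g → R) := by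
      ext k
      simp [Finset.sum_apply, Pi.single_apply]
    rw [this]
    exact Submodule.sum_mem _ fun i _ => Submodule.smul_mem_smul (h i) trivial

lemma precomplete_pi (I : Ideal R) [IsPrecomplete I R] (g : ℕ) : IsPrecomplete I (Fin g → R) := by
  refine ⟨fun f hf => ?_⟩
  have h1 : ∀ i, ∃ L : R, ∀ n, f n i ≡ L [SMOD (I ^ n • ⊤ : Submodule R R)] := by
    intro i
    refine IsPrecomplete.prec (I := I) (M := R) inferInstance (f := fun n => f n i) ?_
    intro m n hmn
    have := hf hmn
    rw [SModEq.sub_mem, mem_smul_top_pi] at this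
    rw [SModEq.sub_mem]
    simpa using this i
  choose L hL using h1
  refine ⟨L, fun n => ?_⟩
  rw [SModEq.sub_mem, mem_smul_top_pi]
  intro i
  have := hL i n
  rw [SModEq.sub_mem] at this
  simpa using this

lemma finite_of_quot (I J : Ideal R) [IsPrecomplete I R] (hJ : J ≤ I) (K : Type u) [AddCommGroup K] [Module R K]
    [IsHausdorff I K] (h : Module.Finite R (K ⧸ (J • ⊤ : Submodule R K))) : Module.Finite R K := by
  obtain ⟨g, p, hp⟩ := Module.Finite.exists_fin' R (K ⧸ (J • ⊤ : Submodule R K))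
  obtain ⟨f, hf⟩ := Module.projective_lifting_property (J • ⊤ : Submodule R K).mkQ p (Submodule.mkQ_surjective _)
  have := precomplete_pi I g
  refine Module.Finite.of_surjective f (surjective_of_mkQ_comp_surjective (I := I) ?_)
  intro z
  obtain ⟨y, rfl⟩ := Submodule.mkQ_surjective _ z
  obtain ⟨v, hv⟩ := hp (Submodule.mkQ _ y)
  refine ⟨v, ?_⟩
  rw [← hf] at hv
  simp only [LinearMap.comp_apply, Submodule.mkQ_apply] at hv ⊢
  rw [Submodule.Quotient.eq] at hv ⊢
  exact Submodule.smul_mono_left hJ hv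

variable {E : Type u} [AddCommGroup E] [Module R E]
variable {B : Type u} [AddCommGroup B] [Module R B] {S : Type u} [AddCommGroup S] [Module R S]

lemma dual_mem [Module.Injective R E] (J : Ideal R) (hJ : J.FG) (φ : B →ₗ[R] E)
    (h : ∀ b : B, (∀ r ∈ J, r • b = 0) → φ b = 0) : φ ∈ (J • ⊤ : Submodule R (B →ₗ[R] E)) := by
  classical
  obtain ⟨s, rfl⟩ := hJ
  let g : B →ₗ[R] (s → B) := LinearMap.pi fun r => (r : R) • LinearMap.id
  obtain ⟨ψ, hψ⟩ := extend_of_ker_le g φ (by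
    intro b hb
    refine h b ?_
    have h1 : ∀ r ∈ (s : Set R), r • b = 0 := fun r hr => congrFun (show g b = 0 from hb) ⟨r, hr⟩
    intro r hr
    have : Ideal.span (s : Set R) ≤ LinearMap.ker (LinearMap.toSpanSingleton R B b) :=
      Ideal.span_le.2 fun r hr => h1 r hr
    exact this hr)
  have : φ = ∑ r : s, (r : R) • (ψ ∘ₗ LinearMap.single R (fun _ => B) r) := by
    rw [← hψ]
    ext b
    have e : g b = ∑ r : s, (r : R) • LinearMap.single R (fun _ : s => B) r b := by
      ext k
      simp [Finset.sum_apply, g, Pi.single_apply]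
    rw [LinearMap.comp_apply, e]
    simp
  rw [this]
  exact Submodule.sum_mem _ fun r _ => Submodule.smul_mem_smul (Ideal.subset_span r.2) trivial

lemma dual_haus (I : Ideal R) (hB : ∀ b : B, ∃ t, ∀ x ∈ I ^ t, x • b = 0) : IsHausdorff I (B →ₗ[R] E) := by
  refine ⟨fun φ hφ => ?_⟩
  ext b
  obtain ⟨t, ht⟩ := hB b
  have h1 := hφ t
  rw [SModEq.zero] at h1
  refine Submodule.smul_induction_on (p := fun φ => φ b = 0) h1 ?_ ?_
  · intro r hr ψ _
    rw [LinearMap.smul_apply, ← map_smul, ht r hr, map_zero]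
  · intro x y hx hy
    rw [LinearMap.add_apply, hx, hy, add_zero]

lemma dual_fin [IsNoetherianRing R] [Module.Injective R E] (I J : Ideal R) [IsPrecomplete I R] (hJ : J ≤ I)
    (hB : ∀ b : B, ∃ t, ∀ x ∈ I ^ t, x • b = 0) (j : S →ₗ[R] B)
    (hj : ∀ b : B, (∀ r ∈ J, r • b = 0) → ∃ s, j s = b) (hS : Module.Finite R (S →ₗ[R] E)) :
    Module.Finite R (B →ₗ[R] E) := by
  have := dual_haus (E := E) I hB
  refine finite_of_quot I J hJ _ ?_
  let ρ : (B →ₗ[R] E) →ₗ[R] (S →ₗ[R] E) := LinearMap.lcomp R E j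
  have hk : LinearMap.ker ρ ≤ (J • ⊤ : Submodule R (B →ₗ[R] E)) := by
    intro φ hφ
    refine dual_mem J (IsNoetherian.noetherian J) φ fun b hb => ?_
    obtain ⟨s, rfl⟩ := hj b hb
    exact LinearMap.congr_fun (show ρ φ = 0 from hφ) s
  have : Module.Finite R ((B →ₗ[R] E) ⧸ LinearMap.ker ρ) :=
    Module.Finite.equiv ρ.quotKerEquivRange.symm
  exact Module.Finite.of_surjective (Submodule.factor hk) (Submodule.factor_surjective hk)

lemma cogen [IsLocalRing R] [Module.Injective R E] {e : E} (he0 : e ≠ 0)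
    (he : ∀ r ∈ IsLocalRing.maximalIdeal R, r • e = 0) {b : B} (h : ∀ φ : B →ₗ[R] E, φ b = 0) : b = 0 := by
  by_contra hb
  obtain ⟨ψ, hψ⟩ := extend_of_ker_le (LinearMap.toSpanSingleton R B b) (LinearMap.toSpanSingleton R E e) (by
    intro r hr
    refine he r ?_
    rw [IsLocalRing.mem_maximalIdeal, mem_nonunits_iff]
    intro hu
    exact hb ((hu.smul_eq_zero).1 hr))
  apply he0
  have := LinearMap.congr_fun hψ 1
  simp only [LinearMap.comp_apply, LinearMap.toSpanSingleton_apply, one_smul, h] at this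
  exact this.symm

lemma base_fin [IsNoetherianRing R] [IsLocalRing R] [Module.Injective R E]
    [IsPrecomplete (IsLocalRing.maximalIdeal R) R] {e : E}
    (he : ∀ e' : E, (∀ r ∈ IsLocalRing.maximalIdeal R, r • e' = 0) → ∃ c : R, e' = c • e)
    [Module.Finite R B] (hB : ∀ b : B, ∃ t, ∀ x ∈ (IsLocalRing.maximalIdeal R) ^ t, x • b = 0) :
    Module.Finite R (B →ₗ[R] E) := by
  set m := IsLocalRing.maximalIdeal R
  let S : Submodule R B := ⨅ r ∈ m, LinearMap.ker (r • LinearMap.id : B →ₗ[R] B)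
  have hS : ∀ b, b ∈ S ↔ ∀ r ∈ m, r • b = 0 := by intro b; simp [S]
  refine dual_fin m m le_rfl hB S.subtype (fun b hb => ⟨⟨b, (hS b).2 hb⟩, rfl⟩) ?_
  obtain ⟨g, p, hp⟩ := Module.Finite.exists_fin' R S
  let F : Submodule R E := Submodule.span R {e}
  have hF : ∀ (φ : S →ₗ[R] E) s, φ s ∈ F := by
    intro φ s
    obtain ⟨c, hc⟩ := he (φ s) (fun r hr => by
      rw [← map_smul, show r • s = 0 from Subtype.ext ((hS _).1 s.2 r hr), map_zero])
    rw [hc]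
    exact Submodule.smul_mem _ _ (Submodule.mem_span_singleton_self e)
  let T : (S →ₗ[R] E) →ₗ[R] (Fin g → F) :=
    { toFun := fun φ i => ⟨φ (p (Pi.single i 1)), hF _ _⟩
      map_add' := fun φ ψ => rfl
      map_smul' := fun r φ => rfl }
  have : Module.Finite R F := Module.Finite.span_singleton R e
  refine Module.Finite.of_injective T ?_
  rw [injective_iff_map_eq_zero]
  intro φ hφ
  have h1 : φ ∘ₗ p = 0 := by
    refine LinearMap.pi_ext' fun i => ?_
    ext
    have := congrArg Subtype.val (congrFun hφ i)
    simpa [T] using this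
  ext s
  obtain ⟨v, rfl⟩ := hp s
  exact LinearMap.congr_fun h1 v

lemma radical_le [IsNoetherianRing R] [IsLocalRing R] [Module.Injective R E] {e : E} (he0 : e ≠ 0)
    (he : ∀ r ∈ IsLocalRing.maximalIdeal R, r • e = 0) [Module.Finite R (B →ₗ[R] E)] (I J : Ideal R)
    (h : ∀ b : B, (∀ r ∈ J, r • b = 0) → ∀ y ∈ I, y • b = 0) :
    I ≤ (J ⊔ Module.annihilator R B).radical := by
  intro y hy
  obtain ⟨p, hp, -, hcoeff, haev⟩ := LinearMap.exists_monic_and_natDegree_eq_and_coeff_mem_pow_and_aeval_eq_zero R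
      (y • LinearMap.id : (B →ₗ[R] E) →ₗ[R] (B →ₗ[R] E)) J (by
        rintro _ ⟨φ, rfl⟩
        refine dual_mem J (IsNoetherian.noetherian J) _ fun b hb => ?_
        simp only [LinearMap.smul_apply, LinearMap.id_apply]
        rw [← map_smul, h b hb y hy, map_zero])
  have h1 : p.eval y ∈ Module.annihilator R B := by
    refine Module.mem_annihilator.2 fun b => cogen he0 he fun φ => ?_
    have e1 : (y • LinearMap.id : (B →ₗ[R] E) →ₗ[R] (B →ₗ[R] E)) = algebraMap R (Module.End R (B →ₗ[R] E)) y := rfl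
    rw [e1, Polynomial.aeval_algebraMap_apply] at haev
    rw [map_smul]
    exact LinearMap.congr_fun (LinearMap.congr_fun haev φ) b
  set P := J ⊔ Module.annihilator R B
  have h2 : p.map (Ideal.Quotient.mk P) = Polynomial.X ^ p.natDegree := by
    ext k
    rw [Polynomial.coeff_map, Polynomial.coeff_X_pow]
    split_ifs with hk
    · rw [hk, hp.coeff_natDegree, map_one]
    · rcases lt_or_gt_of_ne hk with hk | hk
      · rw [Ideal.Quotient.eq_zero_iff_mem]
        exact le_sup_left (a := J) (Ideal.pow_le_self (by omega) (hcoeff k))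
      · rw [Polynomial.coeff_eq_zero_of_natDegree_lt hk, map_zero]
  have h3 : (p.map (Ideal.Quotient.mk P)).eval (Ideal.Quotient.mk P y) = 0 := by
    rw [Polynomial.eval_map_apply, Ideal.Quotient.eq_zero_iff_mem]; exact le_sup_right (a := J) h1
  rw [h2, Polynomial.eval_pow, Polynomial.eval_X, ← map_pow, Ideal.Quotient.eq_zero_iff_mem] at h3
  exact ⟨_, h3⟩
end
end LC

set_option linter.unusedSectionVars false
namespace LC

section
variable {R : Type u} [CommRing R]

lemma exists_reg [IsNoetherianRing R] {a : Ideal R} {N : Type u} [AddCommGroup N] [Module R N] [Module.Finite R N]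
    (h : Gam a N = ⊥) : ∃ x ∈ a, ∀ n : N, x • n = 0 → n = 0 := by
  by_contra hc
  push Not at hc
  have h1 : (a : Set R) ⊆ ⋃ p ∈ associatedPrimes R N, ((id p : Ideal R) : Set R) := by
    intro x hx
    have := biUnion_associatedPrimes_eq_zero_divisors R N
    simp only [id]
    rw [this]
    obtain ⟨n, hn, hn0⟩ := hc x hx
    exact ⟨n, hn0, hn⟩
  obtain ⟨p, hp, hap⟩ := (Ideal.subset_union_prime_finite (associatedPrimes.finite R N) (f := id) ⊤ ⊤
    (fun p hp _ _ => hp.1)).1 h1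
  obtain ⟨hpp, n, hn⟩ := isAssociatedPrime_iff.1 hp
  have hn' : ∀ r, r ∈ p ↔ r • n = 0 := by
    intro r
    rw [hn, Submodule.mem_colon_singleton]
    simp
  have : n ∈ Gam a N := ⟨1, fun x hx => (hn' x).1 (hap (by simpa using hx))⟩
  rw [h, Submodule.mem_bot] at this
  exact hpp.ne_top ((Ideal.eq_top_iff_one _).2 ((hn' 1).2 (by simp [this])))

lemma tors_step [IsNoetherianRing R] {m : Ideal R} {B : Type u} [AddCommGroup B] [Module R B] (x : R)
    (h : ∀ b : B, x • b = 0 → b ∈ Gam m B) : ∀ (k : ℕ) (b : B), x ^ k • b = 0 → b ∈ Gam m B := by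
  intro k
  induction k with
  | zero =>
    intro b hb
    rw [pow_zero, one_smul] at hb
    rw [hb]; exact zero_mem _
  | succ k ih =>
    intro b hb
    obtain ⟨t, ht⟩ := ih (x • b) (by rwa [smul_smul, ← pow_succ])
    have h1 : (Gam m B).mkQ b ∈ Gam m (B ⧸ Gam m B) := by
      refine ⟨t, fun y hy => ?_⟩
      rw [← map_smul, Submodule.mkQ_apply, Submodule.Quotient.mk_eq_zero]
      refine h _ ?_
      rw [smul_comm]
      exact ht y hy
    rw [Gam_quot m B (IsNoetherian.noetherian m), Submodule.mem_bot, Submodule.mkQ_apply,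
      Submodule.Quotient.mk_eq_zero] at h1
    exact h1

variable [IsNoetherianRing R] [IsLocalRing R]

local notation "𝔪" => IsLocalRing.maximalIdeal R

lemma max_le_of_dim_zero {N : Type u} [AddCommGroup N] [Module R N] [Module.Finite R N]
    (h : Module.supportDim R N ≤ (0 : ℕ)) : 𝔪 ≤ (Module.annihilator R N).radical := by
  rw [Module.supportDim_eq_ringKrullDim_quotient_annihilator] at h
  obtain ⟨l, hl, -, hr⟩ := exists_list 𝔪 (IsLocalRing.maximalIdeal.isMaximal R).ne_top 0 _ h
  rw [List.length_eq_zero_iff] at hl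
  subst hl
  simpa using hr

lemma Gam_all {N : Type u} [AddCommGroup N] [Module R N] {I : Ideal R} (h : 𝔪 ≤ I.radical)
    (hI : ∀ r ∈ I, ∀ n : N, r • n = 0) (n : N) : n ∈ Gam 𝔪 N :=
  Gam_mono (IsNoetherian.noetherian _) h (Gam_of_killed hI n)

/-- uniform power killing finite torsion module -/
lemma rad_of_fin {N : Type u} [AddCommGroup N] [Module R N] [Module.Finite R N]
    (h : ∀ n : N, n ∈ Gam 𝔪 N) : 𝔪 ≤ (Module.annihilator R N).radical := by
  obtain ⟨s, hs⟩ := (Module.finite_def.1 ‹Module.Finite R N›)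
  intro x hx
  have h1 : ∀ n : N, ∃ t, x ^ t • n = 0 := fun n => by
    obtain ⟨t, ht⟩ := h n
    exact ⟨t, ht _ (Ideal.pow_mem_pow hx t)⟩
  choose t ht using h1
  refine ⟨∑ n ∈ s, t n, Module.mem_annihilator.2 fun n => ?_⟩
  have h2 : (⊤ : Submodule R N) ≤ LinearMap.ker (x ^ (∑ n ∈ s, t n) • LinearMap.id : N →ₗ[R] N) := by
    rw [← hs, Submodule.span_le]
    intro y hy
    have : t y ≤ ∑ n ∈ s, t n := Finset.single_le_sum (fun _ _ => Nat.zero_le _) hy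
    obtain ⟨c, hc⟩ := Nat.exists_eq_add_of_le this
    rw [hc]
    change x ^ (t y + c) • y = 0
    rw [pow_add, mul_comm, mul_smul, ht, smul_zero]
  exact h2 (Submodule.mem_top (x := n))

variable {E : Type u} [AddCommGroup E] [Module R E] [Module.Injective R E] {e : E}

def Good (E : Type u) [AddCommGroup E] [Module R E] (a : Ideal R) (s : ℕ) (B : Type u) [AddCommGroup B] [Module R B] : Prop :=
  (∀ b : B, b ∈ Gam 𝔪 B) ∧ Module.Finite R (B →ₗ[R] E) ∧ ∃ l : List R, l.length = s ∧ (∀ x ∈ l, x ∈ a) ∧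
    𝔪 ≤ (Ideal.span {x | x ∈ l} ⊔ Module.annihilator R B).radical

lemma Good.equiv {a : Ideal R} {s : ℕ} {B B' : Type u} [AddCommGroup B] [Module R B] [AddCommGroup B'] [Module R B']
    (h : Good E a s B) (f : B ≃ₗ[R] B') : Good E a s B' := by
  obtain ⟨h1, h2, l, h3, h4, h5⟩ := h
  refine ⟨fun b => ?_, Module.Finite.equiv (LinearEquiv.arrowCongr f (LinearEquiv.refl R E)), l, h3, h4, ?_⟩
  · have := Gam_map (f : B →ₗ[R] B') (h1 (f.symm b))
    simpa using this
  · rwa [← f.annihilator_eq]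

lemma CD [IsAdicComplete 𝔪 R] (he0 : e ≠ 0) (he1 : ∀ r ∈ 𝔪, r • e = 0)
    (he : ∀ e' : E, (∀ r ∈ 𝔪, r • e' = 0) → ∃ c : R, e' = c • e) (a : Ideal R) (ha : a ≠ ⊤) (s : ℕ) :
    ∀ (N : Type u) [AddCommGroup N] [Module R N] [Module.Finite R N],
    (a = 𝔪 ∨ Module.supportDim R N ≤ s) → Good E a s (H a s N) := by
  have ham : a ≤ 𝔪 := IsLocalRing.le_maximalIdeal ha
  induction s with
  | zero =>
    intro N _ _ _ h
    have hfin : Module.Finite R (H a 0 N) := Module.Finite.of_injective (ev a N) ev_inj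
    have htor : ∀ b : H a 0 N, b ∈ Gam 𝔪 (H a 0 N) := by
      intro b
      rcases h with h | h
      · subst h
        exact torsion b
      · have h1 := max_le_of_dim_zero h
        refine Gam_all h1 ?_ b
        intro r hr n
        apply ev_inj
        rw [map_smul, map_zero, Module.mem_annihilator.1 hr]
    refine ⟨htor, base_fin he htor, [], rfl, by simp, ?_⟩
    simpa using rad_of_fin htor
  | succ s ih =>
    have key : ∀ (N : Type u) [AddCommGroup N] [Module R N] [Module.Finite R N],
      (a = 𝔪 ∨ Module.supportDim R N ≤ (s + 1 : ℕ)) → Gam a N = ⊥ → Good E a (s+1) (H a (s+1) N) := by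
      intro N _ _ _ h hG
      obtain ⟨x, hxa, hx⟩ := exists_reg hG
      obtain ⟨δ, hδ⟩ := exists_delta_reg (a := a) hx s
      obtain ⟨h1, h2, l, hl, hla, hlr⟩ := ih (QuotSMulTop x N) (h.imp id fun h => by
        refine wb_succ_le ?_
        rw [Module.supportDim_quotSMulTop_succ_eq_supportDim
          ((isSMulRegular_iff_right_eq_zero_of_smul).2 hx) (ham hxa)]
        exact h)
      have htor : ∀ b : H a (s+1) N, b ∈ Gam 𝔪 (H a (s+1) N) := by
        intro b
        obtain ⟨t, ht⟩ := torsion b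
        refine tors_step x ?_ t b (ht _ (Ideal.pow_mem_pow hxa t))
        intro b hb
        obtain ⟨y, rfl⟩ := (hδ b).1 hb
        exact Gam_map δ (h1 y)
      have hfin := dual_fin (E := E) 𝔪 (Ideal.span {x}) ((Ideal.span_singleton_le_iff_mem _).2 (ham hxa)) htor δ
        (fun b hb => (hδ b).1 (hb x (Ideal.mem_span_singleton_self x))) h2
      refine ⟨htor, hfin, x :: l, by simp [hl], ?_, ?_⟩
      · intro y hy
        rcases List.mem_cons.1 hy with rfl | hy
        · exact hxa
        · exact hla y hy
      · refine hlr.trans ?_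
        rw [Ideal.radical_le_radical_iff]
        have h3 := radical_le (E := E) (B := H a (s+1) N) he0 he1
          (Ideal.span {x | x ∈ l} ⊔ Module.annihilator R (H a s (QuotSMulTop x N)))
          (Ideal.span {y | y ∈ x :: l}) (by
            intro b hb y hy
            obtain ⟨w, rfl⟩ := (hδ b).1 (hb x (Ideal.subset_span (by simp)))
            obtain ⟨u, hu, v, hv, rfl⟩ := Submodule.mem_sup.1 hy
            rw [add_smul, ← map_smul δ v, Module.mem_annihilator.1 hv, map_zero, add_zero]
            refine hb u ?_
            exact Ideal.span_mono (fun z hz => List.mem_cons_of_mem _ hz) hu)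
        exact h3
    intro N _ _ _ h
    have hb := Hmap_bij_of_ker_tors (a := a) (Submodule.mkQ_surjective (Gam a N)) (by simp) s
    refine Good.equiv ?_ (LinearEquiv.ofBijective _ hb).symm
    exact key _ (h.imp id fun h => (Module.supportDim_le_of_surjective _ (Submodule.mkQ_surjective _)).trans h)
      (Gam_quot a N (IsNoetherian.noetherian a))
end
end LC

set_option linter.unusedSectionVars false
namespace LC

section
variable {R : Type u} [CommRing R] [IsNoetherianRing R] [IsLocalRing R]

local notation "𝔪" => IsLocalRing.maximalIdeal R

lemma exists_param [IsAdicComplete 𝔪 R] (a : Ideal R) (ha : a ≠ ⊤) (s : ℕ)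
    (N : Type u) [AddCommGroup N] [Module R N] [Module.Finite R N]
    (h : a = 𝔪 ∨ Module.supportDim R N ≤ s) : ∃ l : List R, l.length = s ∧ (∀ x ∈ l, x ∈ a) ∧
    𝔪 ≤ (Ideal.span {x | x ∈ l} ⊔ Module.annihilator R (H a s N)).radical := by
  obtain ⟨E, _, _, hE, e, he0, he1, he⟩ := exists_hull (R := R)
  exact (CD he0 he1 he a ha s N h).2.2

lemma ann_le {a : Ideal R} {d : ℕ} (P : Ideal R) [P.IsPrime] (hd : ringKrullDim (R ⧸ P) ≤ d)
    (h : ¬ Subsingleton (H a d (R ⧸ P))) : Module.annihilator R (H a d (R ⧸ P)) ≤ P := by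
  intro b hb
  by_contra hbP
  apply h
  refine H_zero_of_quot a d (Ideal.span {b}) (R ⧸ P) ?_ ?_ ?_
  · rwa [Module.supportDim_quotient_eq_ringKrullDim]
  · intro r hr z
    obtain ⟨c, rfl⟩ := Ideal.mem_span_singleton'.1 hr
    rw [mul_smul, Module.mem_annihilator.1 hb, smul_zero]
  · intro N' _ _ g hg hk
    have : Module.Finite R N' := Module.Finite.of_surjective g hg
    refine dim_lt_of_killed P hbP hd ?_ (fun n => hk b (Ideal.mem_span_singleton_self b) n)
    intro r hr n
    obtain ⟨z, rfl⟩ := hg n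
    obtain ⟨c, rfl⟩ := Submodule.Quotient.mk_surjective _ z
    rw [← map_smul, ← Submodule.Quotient.mk_smul,
      (Submodule.Quotient.mk_eq_zero P).2 (by rw [smul_eq_mul]; exact Ideal.mul_mem_right _ _ hr), map_zero]

/-- Lichtenbaum–Hartshorne -/
lemma LHVT [IsAdicComplete 𝔪 R] {a : Ideal R} {d : ℕ} (P : Ideal R) [P.IsPrime] (hd : ringKrullDim (R ⧸ P) ≤ d)
    (h : ¬ Subsingleton (H a d (R ⧸ P))) : 𝔪 ≤ (a ⊔ P).radical := by
  have ha : a ≠ ⊤ := fun ha => h (H_top ha)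
  obtain ⟨l, -, hla, hr⟩ := exists_param a ha d (R ⧸ P) (Or.inr (by
    rwa [Module.supportDim_quotient_eq_ringKrullDim]))
  refine hr.trans (Ideal.radical_mono (sup_le_sup (Ideal.span_le.2 hla) (ann_le P hd h)))

lemma M1 [IsAdicComplete 𝔪 R] {d : ℕ} (P : Ideal R) [P.IsPrime] {N : Type u} [AddCommGroup N] [Module R N]
    [Module.Finite R N] (hass : ∀ p ∈ associatedPrimes R N, p = P) (hd : Module.supportDim R N ≤ d)
    (hP : ¬ Subsingleton (H 𝔪 d (R ⧸ P))) (r : R) (hr : ∀ h : H 𝔪 d N, r • h = 0) : ∀ n : N, r • n = 0 := by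
  cases d with
  | zero =>
    have h1 := max_le_of_dim_zero hd
    have h2 := tors_H0 (a := 𝔪) (N := N) (Gam_all h1 fun r hr n => Module.mem_annihilator.1 hr n)
    intro n
    obtain ⟨h, rfl⟩ := h2.2 n
    rw [← map_smul, hr, map_zero]
  | succ d =>
    let f : N →ₗ[R] N := r • LinearMap.id
    let J : Submodule R N := LinearMap.range f
    have hJd : Module.supportDim R J ≤ (d + 1 : ℕ) :=
      (Module.supportDim_le_of_injective _ (Submodule.injective_subtype J)).trans hd
    obtain ⟨δ, -, h2⟩ := exists_delta (a := 𝔪) (Submodule.injective_subtype J) (LinearMap.exact_subtype_mkQ J)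
      (Submodule.mkQ_surjective J) d
    have hδ : Function.Surjective δ := by
      intro y
      refine (h2 y).1 ?_
      obtain ⟨z, rfl⟩ := H_surj (a := 𝔪) hd (LinearMap.surjective_rangeRestrict f) y
      rw [← LinearMap.comp_apply, ← Hmap_comp]
      have : J.subtype ∘ₗ f.rangeRestrict = r • LinearMap.id := by ext; rfl
      rw [this, Hmap_smul_id]
      exact hr z
    obtain ⟨l, hl, hlm, hlr⟩ := exists_param 𝔪 (IsLocalRing.maximalIdeal.isMaximal R).ne_top d (N ⧸ J) (Or.inl rfl)
    have hdim : ringKrullDim (R ⧸ Module.annihilator R (H 𝔪 (d+1) J)) ≤ (d : ℕ) := by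
      refine (dim_le_of_list l _ hlm (hlr.trans (Ideal.radical_mono ?_))).trans (by rw [hl])
      rw [sup_comm]
      exact sup_le_sup_right (LinearMap.annihilator_le_of_surjective δ hδ) _
    have h0 : Subsingleton (H 𝔪 (d+1) J) := by
      refine H_zero_of_quot 𝔪 (d+1) (Module.annihilator R (H 𝔪 (d+1) J)) J hJd
        (fun r hr h => Module.mem_annihilator.1 hr h) ?_
      intro N' _ _ g hg hk
      have : Module.Finite R N' := Module.Finite.of_surjective g hg
      exact H_vanish (d := d) ((dim_le_of_killed hk).trans hdim) (by omega)
    by_contra hc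
    have : Nontrivial J := by
      rw [Submodule.nontrivial_iff_ne_bot]
      intro hJ
      apply hc
      intro n
      have : f n ∈ J := ⟨n, rfl⟩
      rw [hJ] at this
      exact this
    obtain ⟨p, hp⟩ := associatedPrimes.nonempty R J
    have hpP := hass p (associatedPrimes.subset_of_injective (Submodule.injective_subtype J) hp)
    subst hpP
    refine hP (NV hJd p ?_ h0)
    have := IsAssociatedPrime.annihilator_le hp
    rwa [Submodule.annihilator_top] at this

lemma exists_kill {N : Type u} [AddCommGroup N] [Module R N] (P : Ideal R) [hP : P.IsPrime] (L : Submodule R N)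
    (hL : L.FG) (h : ∀ n ∈ L, ∃ s ∉ P, s • n = 0) : ∃ s ∉ P, ∀ n ∈ L, s • n = 0 := by
  classical
  obtain ⟨F, rfl⟩ := hL
  have h' : ∀ n : N, ∃ s ∉ P, n ∈ F → s • n = 0 := by
    intro n
    by_cases hn : n ∈ F
    · obtain ⟨s, hs, hs'⟩ := h n (Submodule.subset_span hn)
      exact ⟨s, hs, fun _ => hs'⟩
    · exact ⟨1, fun hc => hP.ne_top ((Ideal.eq_top_iff_one _).2 hc), fun hc => absurd hc hn⟩
  choose s hs hs' using h'
  refine ⟨∏ n ∈ F, s n, ?_, ?_⟩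
  · intro hc
    obtain ⟨n, _, hn⟩ := (hP.prod_mem_iff).1 hc
    exact hs n hn
  · intro n hn
    have : Submodule.span R (F : Set N) ≤ LinearMap.ker ((∏ n ∈ F, s n) • LinearMap.id : N →ₗ[R] N) := by
      rw [Submodule.span_le]
      intro y hy
      change (∏ n ∈ F, s n) • y = 0
      rw [← Finset.prod_erase_mul _ _ hy, mul_smul, hs' y hy, smul_zero]
    exact this hn

def locKer (P : Ideal R) [hP : P.IsPrime] (N : Type u) [AddCommGroup N] [Module R N] : Submodule R N where
  carrier := {n | ∃ s ∉ P, s • n = 0}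
  zero_mem' := ⟨1, fun hc => hP.ne_top ((Ideal.eq_top_iff_one _).2 hc), by simp⟩
  add_mem' := by
    rintro x y ⟨s, hs, hsx⟩ ⟨t, ht, hty⟩
    refine ⟨s * t, fun hc => (hP.mem_or_mem hc).elim hs ht, ?_⟩
    rw [smul_add, mul_smul s t y, hty, smul_zero, add_zero, mul_comm, mul_smul, hsx, smul_zero]
  smul_mem' := by
    rintro c x ⟨s, hs, hsx⟩
    exact ⟨s, hs, by rw [smul_comm, hsx, smul_zero]⟩

lemma A1 [IsAdicComplete 𝔪 R] {a : Ideal R} {d : ℕ} {N : Type u} [AddCommGroup N] [Module R N]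
    [Module.Finite R N] (hd : Module.supportDim R N ≤ d)
    (r : R) (hr : ∀ h : H a d N, r • h = 0) :
    Subsingleton (H a d (LinearMap.range (r • LinearMap.id : N →ₗ[R] N))) := by
  set J : Submodule R N := LinearMap.range (r • LinearMap.id : N →ₗ[R] N) with hJ
  by_contra hc
  obtain ⟨P, hPp, hle, hP⟩ := NVconv J hc
  have ha : a ≠ ⊤ := fun ha => hP (H_top ha)
  have hNP : Module.annihilator R N ≤ P :=
    (LinearMap.annihilator_le_of_injective _ (Submodule.injective_subtype J)).trans hle
  have hd' := hd
  rw [Module.supportDim_eq_ringKrullDim_quotient_annihilator] at hd'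
  have hPd : ringKrullDim (R ⧸ P) ≤ d := (dim_anti hNP).trans hd'
  have hmin : ∀ Q : Ideal R, Q.IsPrime → Module.annihilator R N ≤ Q → Q ≤ P → Q = P := by
    intro Q hQ h1 h2
    by_contra hne
    obtain ⟨b, hb, hbQ⟩ := SetLike.exists_of_lt (lt_of_le_of_ne h2 hne)
    refine hP (dim_lt_of_killed Q hbQ ((dim_anti h1).trans hd') ?_ ?_)
    · intro r hr n
      obtain ⟨c, rfl⟩ := Submodule.Quotient.mk_surjective _ n
      rw [← Submodule.Quotient.mk_smul, Submodule.Quotient.mk_eq_zero, smul_eq_mul]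
      exact Ideal.mul_mem_right _ _ (h2 hr)
    · intro n
      obtain ⟨c, rfl⟩ := Submodule.Quotient.mk_surjective _ n
      rw [← Submodule.Quotient.mk_smul, Submodule.Quotient.mk_eq_zero, smul_eq_mul]
      exact Ideal.mul_mem_right _ _ hb
  let T := locKer P N
  have hQN : Module.annihilator R N ≤ Module.annihilator R (N ⧸ T) :=
    LinearMap.annihilator_le_of_surjective T.mkQ (Submodule.mkQ_surjective T)
  have hQd : Module.supportDim R (N ⧸ T) ≤ d :=
    (Module.supportDim_le_of_surjective _ (Submodule.mkQ_surjective T)).trans hd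
  have hass : ∀ p ∈ associatedPrimes R (N ⧸ T), p = P := by
    intro p hp
    obtain ⟨hpp, q, hq⟩ := isAssociatedPrime_iff.1 hp
    have hq' : ∀ r, r ∈ p ↔ r • q = 0 := by
      intro r
      rw [hq, Submodule.mem_colon_singleton]
      simp
    refine hmin p hpp ?_ ?_
    · intro s hs
      exact (hq' s).2 (Module.mem_annihilator.1 (hQN hs) q)
    · intro s hs
      by_contra hsP
      obtain ⟨n, rfl⟩ := Submodule.mkQ_surjective _ q
      have h1 := (hq' s).1 hs
      rw [← map_smul, Submodule.mkQ_apply, Submodule.Quotient.mk_eq_zero] at h1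
      obtain ⟨t, ht, h2⟩ := h1
      have h3 : n ∈ T := ⟨t * s, fun hc => (hPp.mem_or_mem hc).elim ht hsP, by rwa [mul_smul]⟩
      refine hpp.ne_top ((Ideal.eq_top_iff_one _).2 ((hq' 1).2 ?_))
      rw [one_smul, Submodule.mkQ_apply, Submodule.Quotient.mk_eq_zero]
      exact h3
  have hrad : P ≤ (Module.annihilator R (N ⧸ T)).radical := by
    rw [← Ideal.sInf_minimalPrimes]
    refine le_sInf fun p hp => ?_
    rw [hass p (Module.associatedPrimes.minimalPrimes_annihilator_subset_associatedPrimes R (N ⧸ T) hp)]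
  have hL := LHVT P hPd hP
  obtain ⟨l, hl, hla, hlr⟩ := exists_list a ha d _ hd'
  have hlm : ∀ x ∈ l, x ∈ 𝔪 := fun x hx => IsLocalRing.le_maximalIdeal ha (hla x hx)
  have hall : ∀ I : Ideal R, Module.annihilator R N ≤ I → P ≤ I.radical → ∀ (X : Type u) [AddCommGroup X]
      [Module R X], (∀ r ∈ I, ∀ x : X, r • x = 0) → Nonempty (H a d X ≃ₗ[R] H 𝔪 d X) := by
    intro I hNI hPI X _ _ hk
    have h1 : a ≤ (I ⊔ Ideal.span {x | x ∈ l}).radical := hlr.trans (Ideal.radical_mono (sup_le_sup_right hNI _))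
    have h2 : 𝔪 ≤ (I ⊔ Ideal.span {x | x ∈ l}).radical := by
      refine hL.trans ?_
      rw [Ideal.radical_le_radical_iff]
      exact sup_le h1 (hPI.trans (Ideal.radical_mono le_sup_left))
    obtain ⟨e1⟩ := (comp' (a := a) (N := X) l I hla h1 hk).2
    obtain ⟨e2⟩ := (comp' (a := 𝔪) (N := X) l I hlm h2 hk).2
    rw [hl] at e1 e2
    exact ⟨e1.trans e2.symm⟩
  obtain ⟨e1⟩ := hall _ hQN hrad (N ⧸ T) (fun r hr n => Module.mem_annihilator.1 hr n)
  obtain ⟨e2⟩ := hall P hNP Ideal.le_radical (R ⧸ P) (by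
      intro r hr n
      obtain ⟨c, rfl⟩ := Submodule.Quotient.mk_surjective _ n
      rw [← Submodule.Quotient.mk_smul, Submodule.Quotient.mk_eq_zero, smul_eq_mul]
      exact Ideal.mul_mem_right _ _ hr)
  have hkill := M1 P hass hQd (fun hs => hP (e2.toEquiv.subsingleton)) r (by
    intro h
    obtain ⟨y, rfl⟩ := e1.surjective h
    obtain ⟨z, rfl⟩ := H_surj (a := a) hd (Submodule.mkQ_surjective T) y
    rw [← map_smul, ← map_smul, hr, map_zero, map_zero])
  obtain ⟨s, hs, hs'⟩ := exists_kill P J (IsNoetherian.noetherian J) (by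
    rintro _ ⟨n, rfl⟩
    have := hkill (T.mkQ n)
    rw [← map_smul, Submodule.mkQ_apply, Submodule.Quotient.mk_eq_zero] at this
    exact this)
  exact hs (hle (Module.mem_annihilator.2 fun y => Subtype.ext (hs' y y.2)))
end
end LC

set_option linter.unusedSectionVars false
namespace LC

section
variable {R : Type u} [CommRing R] [IsNoetherianRing R] [IsLocalRing R]

local notation "𝔪" => IsLocalRing.maximalIdeal R

lemma evalA_compat {S : Type u} [CommRing S] (I : Ideal S) {a b : ℕ} (h : a ≤ b) (z : AdicCompletion I S) :
    Ideal.Quotient.factorPow I h (AdicCompletion.evalₐ I b z) = AdicCompletion.evalₐ I a z := by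
  induction z using AdicCompletion.induction_on with
  | h z =>
  rw [AdicCompletion.evalₐ_mk, AdicCompletion.evalₐ_mk]
  have := z.2 h
  rw [SModEq.sub_mem] at this
  change Ideal.Quotient.mk _ _ = _
  rw [eq_comm, Ideal.Quotient.eq]
  simpa using this

instance hat_noeth : IsNoetherianRing (AdicCompletion 𝔪 R) := by
  obtain ⟨g, x, hx⟩ := Submodule.fg_iff_exists_fin_generating_family.1 (IsNoetherian.noetherian 𝔪)
  let P := MvPolynomial (Fin g) R
  let J : Ideal P := MvPolynomial.idealOfVars (Fin g) R
  let f : P →+* R := (MvPolynomial.aeval x : P →ₐ[R] R).toRingHom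
  have hfX : ∀ i, f (MvPolynomial.X i) = x i := fun i => MvPolynomial.aeval_X x i
  have hfC : ∀ r, f (algebraMap R P r) = r := fun r => (MvPolynomial.aeval x : P →ₐ[R] R).commutes r
  have hJ : J ≤ (𝔪).comap f := by
    change Ideal.span _ ≤ _
    rw [Ideal.span_le]
    rintro _ ⟨i, rfl⟩
    change f (MvPolynomial.X i) ∈ 𝔪
    rw [hfX, ← hx]
    exact Submodule.subset_span ⟨i, rfl⟩
  have hJn : ∀ n, J ^ n ≤ (𝔪 ^ n).comap f := fun n =>
    (Ideal.pow_right_mono hJ n).trans (Ideal.le_comap_pow f n)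
  let φ : ∀ n, AdicCompletion J P →+* R ⧸ 𝔪 ^ n := fun n =>
    (Ideal.quotientMap (𝔪 ^ n) f (hJn n)).comp (AdicCompletion.evalₐ J n : AdicCompletion J P →+* P ⧸ J ^ n)
  have hφ : ∀ {a b : ℕ} (h : a ≤ b), (Ideal.Quotient.factorPow 𝔪 h).comp (φ b) = φ a := by
    intro a b h
    ext z
    change Ideal.Quotient.factorPow 𝔪 h (Ideal.quotientMap (𝔪 ^ b) f (hJn b) (AdicCompletion.evalₐ J b z)) =
      Ideal.quotientMap (𝔪 ^ a) f (hJn a) (AdicCompletion.evalₐ J a z)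
    rw [← evalA_compat J h]
    obtain ⟨p, hp⟩ := Ideal.Quotient.mk_surjective (AdicCompletion.evalₐ J b z)
    rw [← hp]
    rfl
  let F : AdicCompletion J P →+* AdicCompletion 𝔪 R := AdicCompletion.liftRingHom 𝔪 φ hφ
  have hF : ∀ p : P, F (algebraMap P _ p) = algebraMap R _ (f p) := by
    intro p
    refine AdicCompletion.ext_evalₐ fun n => ?_
    rw [AdicCompletion.evalₐ_liftRingHom, AdicCompletion.algebraMap_apply, AdicCompletion.algebraMap_apply,
      AdicCompletion.evalₐ_of]
    have h2 : φ n (AdicCompletion.of J P p) =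
        Ideal.quotientMap (𝔪 ^ n) f (hJn n) (AdicCompletion.evalₐ J n (AdicCompletion.of J P p)) := rfl
    rw [AdicCompletion.evalₐ_of] at h2
    exact h2
  have hcomp : IsAdicComplete (J.map (algebraMap P (AdicCompletion J P))) (AdicCompletion J P) :=
    AdicCompletion.isAdicComplete_self J (MvPolynomial.idealOfVars_fg _ _)
  have hmap : (J.map (algebraMap P (AdicCompletion J P))).map F =
      IsLocalRing.maximalIdeal (AdicCompletion 𝔪 R) := by
    rw [AdicCompletion.maximalIdeal_eq_map, Ideal.map_map]
    have : F.comp (algebraMap P (AdicCompletion J P)) = (algebraMap R (AdicCompletion 𝔪 R)).comp f :=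
      RingHom.ext hF
    rw [this, ← Ideal.map_map]
    congr 1
    refine le_antisymm (Ideal.map_le_iff_le_comap.2 hJ) ?_
    conv_lhs => rw [← hx]
    change Ideal.span _ ≤ _
    rw [Ideal.span_le]
    rintro _ ⟨i, rfl⟩
    rw [← hfX]
    exact Ideal.mem_map_of_mem f (Ideal.subset_span ⟨i, rfl⟩)
  have hsurj : Function.Surjective F := by
    have : IsHausdorff ((J.map (algebraMap P (AdicCompletion J P))).map F) (AdicCompletion 𝔪 R) := by
      rw [hmap]; infer_instance
    refine surjective_of_mk_map_comp_surjective (I := J.map (algebraMap P (AdicCompletion J P))) F ?_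
    intro z
    obtain ⟨y, rfl⟩ := Ideal.Quotient.mk_surjective z
    obtain ⟨w, hw⟩ := (AdicCompletion.residueField_map_bijective R).2 (IsLocalRing.residue _ y)
    obtain ⟨w, rfl⟩ := IsLocalRing.residue_surjective w
    rw [IsLocalRing.ResidueField.map_residue] at hw
    refine ⟨algebraMap P _ (algebraMap R P w), ?_⟩
    rw [RingHom.comp_apply, hF, hfC, Ideal.Quotient.eq, hmap]
    exact Ideal.Quotient.eq.1 hw
  have : IsNoetherianRing (AdicCompletion J P) :=
    isNoetherianRing_of_ringEquiv _ (MvPowerSeries.toAdicCompletionAlgEquiv (Fin g) R).toRingEquiv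
  exact isNoetherianRing_of_surjective _ _ F hsurj

instance hat_ff : Module.FaithfullyFlat R (AdicCompletion 𝔪 R) := Module.FaithfullyFlat.of_flat_of_isLocalHom
end
end LC

set_option linter.unusedSectionVars false
namespace LC

section
variable {R : Type u} [CommRing R] [IsNoetherianRing R] [IsLocalRing R]
open TensorProduct

local notation "𝔪" => IsLocalRing.maximalIdeal R

lemma rad_map {A : Type u} [CommRing A] [Algebra R A] {b I : Ideal R} {l : List R}
    (h : b ≤ (I ⊔ Ideal.span {x | x ∈ l}).radical) :
    b.map (algebraMap R A) ≤
      (I.map (algebraMap R A) ⊔ Ideal.span {y | ∃ x ∈ l, algebraMap R A x = y}).radical := by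
  refine (Ideal.map_mono h).trans ((Ideal.map_radical_le _).trans ?_)
  rw [Ideal.map_sup, Ideal.map_span]
  exact le_of_eq rfl

lemma killed_map {A : Type u} [CommRing A] [Algebra R A] {I : Ideal R} {N : Type u} [AddCommGroup N]
    [Module R N] (hN : ∀ r ∈ I, ∀ n : N, r • n = 0) :
    ∀ s ∈ I.map (algebraMap R A), ∀ z : A ⊗[R] N, s • z = 0 := by
  intro s hs z
  have : I.map (algebraMap R A) ≤ Module.annihilator A (A ⊗[R] N) := by
    rw [Ideal.map_le_iff_le_comap]
    intro r hr
    rw [Ideal.mem_comap, Module.mem_annihilator]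
    intro z
    rw [algebraMap_smul]
    induction z with
    | zero => simp
    | add x y hx hy => rw [smul_add, hx, hy, add_zero]
    | tmul x n => rw [← TensorProduct.tmul_smul, hN r hr, TensorProduct.tmul_zero]
  exact Module.mem_annihilator.1 (this hs) z

lemma descent {a : Ideal R} {d : ℕ} {N : Type u} [AddCommGroup N] [Module R N]
    [Module.Finite R N] (hd : Module.supportDim R N ≤ d)
    (r : R) (hr : ∀ h : H a d N, r • h = 0) :
    Subsingleton (H a d (LinearMap.range (r • LinearMap.id : N →ₗ[R] N))) := by
  by_cases ha : a = ⊤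
  · exact H_top ha
  set J : Submodule R N := LinearMap.range (r • LinearMap.id : N →ₗ[R] N) with hJ
  let A := AdicCompletion 𝔪 R
  have hd' := hd
  rw [Module.supportDim_eq_ringKrullDim_quotient_annihilator] at hd'
  set I := Module.annihilator R N with hI
  have hIN : ∀ r ∈ I, ∀ n : N, r • n = 0 := fun r hr n => Module.mem_annihilator.1 hr n
  have hIJ : ∀ r ∈ I, ∀ n : J, r • n = 0 := fun r hr n => Subtype.ext (hIN r hr n.1)
  obtain ⟨l, hl, hla, hrad⟩ := exists_list a ha d I hd'
  subst hl
  -- the dimension of the completion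
  have hdA : Module.supportDim A (A ⊗[R] N) ≤ l.length := by
    refine (dim_le_of_killed (killed_map hIN)).trans ?_
    obtain ⟨l', hl', hla', hrad'⟩ := exists_list 𝔪 (IsLocalRing.maximalIdeal.isMaximal R).ne_top l.length I hd'
    have h1 := rad_map (A := A) hrad'
    rw [← AdicCompletion.maximalIdeal_eq_map] at h1
    have h2 := dim_le_of_list (l'.map (algebraMap R A)) (I.map (algebraMap R A)) ?_ ?_
    · rwa [List.length_map, hl'] at h2
    · intro y hy
      obtain ⟨x, hx, rfl⟩ := List.mem_map.1 hy
      rw [AdicCompletion.maximalIdeal_eq_map]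
      exact Ideal.mem_map_of_mem _ (hla' x hx)
    · simpa only [List.mem_map] using h1
  obtain ⟨e⟩ := (comp' l I hla hrad hIN).2
  obtain ⟨eJ⟩ := (comp' l I hla hrad hIJ).2
  have hka : ∀ x ∈ l, algebraMap R A x ∈ a.map (algebraMap R A) := fun x hx =>
    Ideal.mem_map_of_mem _ (hla x hx)
  obtain ⟨f⟩ := (comp (R := R) (a.map (algebraMap R A)) l (I.map (algebraMap R A)) hka (rad_map hrad)
    (A ⊗[R] N) (Gam_of_killed (killed_map hIN))).2
  obtain ⟨fJ⟩ := (comp (R := R) (a.map (algebraMap R A)) l (I.map (algebraMap R A)) hka (rad_map hrad)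
    (A ⊗[R] J) (Gam_of_killed (killed_map hIJ))).2
  have hkill : ∀ h : H (a.map (algebraMap R A)) l.length (A ⊗[R] N), (algebraMap R A r) • h = 0 := by
    intro h
    apply f.injective
    rw [map_smul, map_zero]
    apply (TensorProduct.AlgebraTensorModule.assoc R R A A N (Cmod l)).injective
    rw [map_smul, map_zero]
    refine killed_map (I := Ideal.span {r}) (N := N ⊗[R] (Cmod l : Type u)) ?_ _
      (Ideal.mem_map_of_mem _ (Ideal.subset_span rfl)) _
    intro s hs n
    obtain ⟨c, rfl⟩ := Ideal.mem_span_singleton'.1 hs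
    rw [mul_smul]
    obtain ⟨h', rfl⟩ := e.surjective n
    rw [← map_smul, hr, map_zero, smul_zero]
  have h0 := A1 hdA (algebraMap R A r) hkill
  have hinj : Function.Injective (J.subtype.baseChange A) :=
    Module.Flat.lTensor_preserves_injective_linearMap (M := A) J.subtype (Submodule.injective_subtype J)
  have hrange : LinearMap.range (J.subtype.baseChange A) =
      LinearMap.range (algebraMap R A r • LinearMap.id : (A ⊗[R] N) →ₗ[A] (A ⊗[R] N)) := by
    have h1 : (J.subtype.baseChange A) ∘ₗ
        ((r • LinearMap.id : N →ₗ[R] N).rangeRestrict.baseChange A) =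
        algebraMap R A r • LinearMap.id := by
      rw [← LinearMap.baseChange_comp]
      ext n
      simp [TensorProduct.smul_tmul', Algebra.smul_def]
    rw [← h1, LinearMap.range_comp_of_range_eq_top]
    rw [LinearMap.range_eq_top]
    exact LinearMap.lTensor_surjective A (LinearMap.surjective_rangeRestrict _)
  let eq : (A ⊗[R] J) ≃ₗ[A] LinearMap.range (algebraMap R A r • LinearMap.id : (A ⊗[R] N) →ₗ[A] (A ⊗[R] N)) :=
    (LinearEquiv.ofInjective _ hinj).trans (LinearEquiv.ofEq _ _ hrange)
  have h1 : Subsingleton (H (a.map (algebraMap R A)) l.length (A ⊗[R] J)) :=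
    (Hequiv _ _ eq).toEquiv.subsingleton
  have h2 : Subsingleton ((A ⊗[R] J) ⊗[R] (Cmod l : Type u)) := fJ.symm.toEquiv.subsingleton
  have h3 : Subsingleton (A ⊗[R] (J ⊗[R] (Cmod l : Type u))) :=
    (TensorProduct.AlgebraTensorModule.assoc R R A A J (Cmod l)).symm.toEquiv.subsingleton
  have h4 : Subsingleton (J ⊗[R] (Cmod l : Type u)) :=
    (Module.FaithfullyFlat.subsingleton_tensorProduct_iff_right R A).1 h3
  exact eJ.toEquiv.subsingleton
end
end LC


namespace LC

section
variable {R : Type u} [CommRing R] [IsNoetherianRing R] [IsLocalRing R]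

lemma cohDim_eq_iff {a P : Ideal R} {d : ℕ} (h : ringKrullDim (R ⧸ P) ≤ d) :
    cohDim a (R ⧸ P) = ((d : ℕ∞) : WithBot ℕ∞) ↔ ¬ Subsingleton (H a d (R ⧸ P)) := by
  have hv : ∀ i : ℕ, LCNonzero a i (R ⧸ P) → i ≤ d := by
    intro i hi
    by_contra hc
    have : Subsingleton (H a i (R ⧸ P)) :=
      H_vanish (d := d) (by rwa [Module.supportDim_quotient_eq_ringKrullDim]) (by omega)
    exact not_nontrivial_iff_subsingleton.2 this hi
  constructor
  · intro hc hs
    have hlt : ∀ i : ℕ, LCNonzero a i (R ⧸ P) → i < d := by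
      intro i hi
      refine lt_of_le_of_ne (hv i hi) ?_
      rintro rfl
      exact not_nontrivial_iff_subsingleton.2 hs hi
    cases d with
    | zero =>
      have : cohDim a (R ⧸ P) ≤ ⊥ := by
        refine sSup_le ?_
        rintro _ ⟨i, rfl, hi⟩
        exact absurd (hlt i hi) (by omega)
      rw [hc] at this
      simp at this
    | succ k =>
      have : cohDim a (R ⧸ P) ≤ ((k : ℕ∞) : WithBot ℕ∞) := by
        refine sSup_le ?_
        rintro _ ⟨i, rfl, hi⟩
        have := hlt i hi
        have : i ≤ k := by omega
        exact_mod_cast this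
      rw [hc] at this
      have : k + 1 ≤ k := by exact_mod_cast this
      omega
  · intro hs
    refine le_antisymm (sSup_le ?_) (le_sSup ⟨d, rfl, not_subsingleton_iff_nontrivial.1 hs⟩)
    rintro _ ⟨i, rfl, hi⟩
    exact_mod_cast hv i hi

end
end LC

open LC

/-- Over a local ring, with `dim M = d`, `H^d_𝔞(M) ≠ 0` and a reduced primary decomposition
`0 = ⋂ N j` of `0` in `M`, `Ann_R(H^d_𝔞(M)) = Ann_R(M ⧸ ⋂_{cd(𝔞, R/p j) = d} N j)`. -/
theorem stmt_12 {R : Type u} [CommRing R] [IsNoetherianRing R] [IsLocalRing R] (𝔞 : Ideal R)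
    (M : Type u) [AddCommGroup M] [Module R M] [Module.Finite R M] [Nontrivial M]
    (d : ℕ) (hd : modDim R M = (d : ℕ∞)) (htop : LCNonzero 𝔞 d M)
    (n : ℕ) (N : Fin n → Submodule R M) (p : Fin n → Ideal R)
    (hdec : (⨅ j, N j) = ⊥) (hprim : ∀ j, IsPrimarySubmodule (N j) (p j))
    (hdist : Function.Injective p)
    (hred : ∀ j, (⨅ k ∈ ({j}ᶜ : Set (Fin n)), N k) ≠ ⊥) :
    Module.annihilator R ((localCohomology 𝔞 d).obj (ModuleCat.of R M)) =
      Module.annihilator R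
        (M ⧸ ⨅ j ∈ {j : Fin n | cohDim 𝔞 (R ⧸ p j) = ((d : ℕ∞) : WithBot ℕ∞)}, N j) := by
  have hd' : ringKrullDim (R ⧸ Module.annihilator R M) ≤ (d : WithBot ℕ∞) := le_of_eq hd
  have hds : Module.supportDim R M ≤ (d : WithBot ℕ∞) := by
    rwa [Module.supportDim_eq_ringKrullDim_quotient_annihilator]
  have hpa : ∀ j, p j ∈ associatedPrimes R (M ⧸ N j) := fun j => by
    rw [show associatedPrimes R (M ⧸ N j) = {p j} from hprim j]; rfl
  have hpp : ∀ j, (p j).IsPrime := fun j => (hpa j).1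
  have hMN : ∀ j, Module.annihilator R M ≤ Module.annihilator R (M ⧸ N j) := fun j =>
    LinearMap.annihilator_le_of_surjective _ (Submodule.mkQ_surjective (N j))
  have hMp : ∀ j, Module.annihilator R M ≤ p j := fun j => by
    have := IsAssociatedPrime.annihilator_le (hpa j)
    rw [Submodule.annihilator_top] at this
    exact (hMN j).trans this
  have hcd : ∀ j, cohDim 𝔞 (R ⧸ p j) = ((d : ℕ∞) : WithBot ℕ∞) ↔ ¬ Subsingleton (H 𝔞 d (R ⧸ p j)) :=
    fun j => cohDim_eq_iff ((dim_anti (hMp j)).trans hd')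
  set T : Submodule R M := ⨅ j ∈ {j : Fin n | cohDim 𝔞 (R ⧸ p j) = ((d : ℕ∞) : WithBot ℕ∞)}, N j with hT
  have hTN : ∀ j, cohDim 𝔞 (R ⧸ p j) = ((d : ℕ∞) : WithBot ℕ∞) → T ≤ N j := fun j hj => iInf₂_le j hj
  refine le_antisymm ?_ ?_
  · intro r hr
    have h0 : Subsingleton (H 𝔞 d (LinearMap.range (r • LinearMap.id : M →ₗ[R] M))) :=
      descent hds r (fun h => Module.mem_annihilator.1 hr h)
    set J := LinearMap.range (r • LinearMap.id : M →ₗ[R] M) with hJ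
    have hdJ : Module.supportDim R J ≤ (d : WithBot ℕ∞) :=
      (Module.supportDim_le_of_injective _ (Submodule.injective_subtype J)).trans hds
    rw [Module.mem_annihilator]
    intro m
    obtain ⟨m, rfl⟩ := Submodule.mkQ_surjective _ m
    rw [← map_smul, Submodule.mkQ_apply, Submodule.Quotient.mk_eq_zero, hT, Submodule.mem_iInf]
    intro j
    rw [Submodule.mem_iInf]
    intro hj
    let f : J →ₗ[R] M ⧸ N j := (N j).mkQ ∘ₗ J.subtype
    have hfs := LinearMap.surjective_rangeRestrict f
    have hY : Subsingleton (H 𝔞 d (LinearMap.range f)) := H_quot_zero hdJ hfs h0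
    have hYd : Module.supportDim R (LinearMap.range f) ≤ (d : WithBot ℕ∞) :=
      (Module.supportDim_le_of_surjective _ hfs).trans hdJ
    by_contra hc
    have : Nontrivial (LinearMap.range f) := by
      refine ⟨⟨⟨f ⟨r • m, ⟨m, rfl⟩⟩, LinearMap.mem_range_self _ _⟩, 0, fun hz => hc ?_⟩⟩
      exact (Submodule.Quotient.mk_eq_zero (N j)).1 (congrArg Subtype.val hz)
    obtain ⟨q, hq⟩ := associatedPrimes.nonempty R (LinearMap.range f)
    have hq' := associatedPrimes.subset_of_injective (Submodule.injective_subtype _) hq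
    rw [show associatedPrimes R (M ⧸ N j) = {p j} from hprim j, Set.mem_singleton_iff] at hq'
    subst hq'
    have hle := IsAssociatedPrime.annihilator_le hq
    rw [Submodule.annihilator_top] at hle
    have := hpp j
    exact (hcd j).1 hj (NV hYd (p j) hle hY)
  · have h0 : Subsingleton (H 𝔞 d T) := by
      by_contra hc
      obtain ⟨P, hPp, hle, hP⟩ := NVconv T hc
      have hmin : ∀ Q : Ideal R, Q.IsPrime → Module.annihilator R M ≤ Q → Q ≤ P → Q = P := by
        intro Q hQ h1 h2
        by_contra hne
        obtain ⟨b, hb, hbQ⟩ := SetLike.exists_of_lt (lt_of_le_of_ne h2 hne)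
        refine hP (dim_lt_of_killed Q hbQ ((dim_anti h1).trans hd') ?_ ?_)
        · intro r hr n
          obtain ⟨c, rfl⟩ := Submodule.Quotient.mk_surjective _ n
          rw [← Submodule.Quotient.mk_smul, Submodule.Quotient.mk_eq_zero, smul_eq_mul]
          exact Ideal.mul_mem_right _ _ (h2 hr)
        · intro n
          obtain ⟨c, rfl⟩ := Submodule.Quotient.mk_surjective _ n
          rw [← Submodule.Quotient.mk_smul, Submodule.Quotient.mk_eq_zero, smul_eq_mul]
          exact Ideal.mul_mem_right _ _ hb
      classical
      let s : Finset (Fin n) := Finset.univ.filter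
        (fun j => cohDim 𝔞 (R ⧸ p j) ≠ ((d : ℕ∞) : WithBot ℕ∞))
      have hinf : s.inf (fun j => Module.annihilator R (M ⧸ N j)) ≤ P := by
        refine le_trans ?_ hle
        intro r hr
        rw [Module.mem_annihilator]
        intro t
        have hz : r • (t : M) ∈ ⨅ j, N j := by
          rw [Submodule.mem_iInf]
          intro j
          by_cases hj : cohDim 𝔞 (R ⧸ p j) = ((d : ℕ∞) : WithBot ℕ∞)
          · exact (N j).smul_mem r (hTN j hj t.2)
          · have h1 : r ∈ Module.annihilator R (M ⧸ N j) :=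
              (Finset.inf_le (f := fun j => Module.annihilator R (M ⧸ N j)) (Finset.mem_filter.2 ⟨Finset.mem_univ j, hj⟩)) hr
            have h2 := Module.mem_annihilator.1 h1 ((N j).mkQ t)
            rwa [← map_smul, Submodule.mkQ_apply, Submodule.Quotient.mk_eq_zero] at h2
        rw [hdec, Submodule.mem_bot] at hz
        exact Subtype.ext hz
      obtain ⟨j, hj, hjP⟩ := (Ideal.IsPrime.inf_le' hPp).1 hinf
      obtain ⟨Q, hQ, hQP⟩ := Ideal.exists_minimalPrimes_le hjP
      have hQa := Module.associatedPrimes.minimalPrimes_annihilator_subset_associatedPrimes R (M ⧸ N j) hQ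
      rw [show associatedPrimes R (M ⧸ N j) = {p j} from hprim j, Set.mem_singleton_iff] at hQa
      subst hQa
      have hPe := hmin (p j) (hpp j) (hMp j) hQP
      rw [← hPe] at hP
      exact (Finset.mem_filter.1 hj).2 ((hcd j).2 hP)
    intro r hr
    rw [Module.mem_annihilator]
    intro h
    change H 𝔞 d M at h
    have hx := exact_mid (a := 𝔞) (Submodule.injective_subtype T) (LinearMap.exact_subtype_mkQ T)
      (Submodule.mkQ_surjective T) d
    have hz : r • (LinearMap.id : (M ⧸ T) →ₗ[R] (M ⧸ T)) = 0 := by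
      refine LinearMap.ext fun m => ?_
      exact Module.mem_annihilator.1 hr m
    have hk : ∀ y : H 𝔞 d (M ⧸ T), r • y = 0 := by
      intro y
      have h1 := Hmap_smul_id (a := 𝔞) (i := d) (N := M ⧸ T) r
      rw [hz, Hmap_zero] at h1
      exact (LinearMap.congr_fun h1 y).symm
    obtain ⟨y, hy⟩ := (hx (r • h)).1 (by rw [map_smul, hk])
    rw [Subsingleton.elim y 0, map_zero] at hy
    exact hy.symm
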